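/- arXiv:2408.14021 — 3 statements merged into one kernel-verified Lean document; each statement's English description precedes it below -/
import Mathlib

section
/- Let R be a commutative Noetherian ring, let m, n ≥ 1, let A be an m×n matrix over R, and let t be an integer with 1 ≤ t ≤ min(m,n). If the determinantal ideal I_t(A) is a proper ideal of R, then every minimal prime ideal over I_t(A) has height at most (m − t + 1)(n − t + 1); in particular the height of I_t(A) is at most (m − t + 1)(n − t + 1). -/
/-- The determinantal ideal `I_t(A)` of an `m × n` matrix `A` over a commutative ring `R`,
generated by all `t × t` minors of `A` (determinants of submatrices obtained by choosing
`t` rows and `t` columns via injections).  For `t ≤ 0` this is the whole ring (the empty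
determinant is `1`), and for `t > min m n` it is the zero ideal (there are no injections). -/
noncomputable def detIdeal {R : Type*} [CommRing R] {m n : ℕ}
    (A : Matrix (Fin m) (Fin n) R) (t : ℤ) : Ideal R :=
  Ideal.span { d : R | ∃ (f : Fin t.toNat → Fin m) (g : Fin t.toNat → Fin n),
    Function.Injective f ∧ Function.Injective g ∧ d = (A.submatrix f g).det }

open Polynomial

namespace Matrix

variable {R S : Type*} [CommRing R] [CommRing S] {ι κ ι' κ' : Type*}

/-- The ideal generated by the `t × t` minors of a matrix with arbitrary index types. Repeated rows
or columns are allowed in the minors, as the corresponding determinants vanish. -/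
def minorsIdeal (A : Matrix ι κ R) (t : ℕ) : Ideal R :=
  Ideal.span (Set.range fun fg : (Fin t → ι) × (Fin t → κ) ↦ (A.submatrix fg.1 fg.2).det)

theorem det_submatrix_mem_minorsIdeal (A : Matrix ι κ R) {t : ℕ} (f : Fin t → ι) (g : Fin t → κ) :
    (A.submatrix f g).det ∈ A.minorsIdeal t :=
  Ideal.subset_span ⟨(f, g), rfl⟩

theorem minorsIdeal_le_iff {A : Matrix ι κ R} {t : ℕ} {I : Ideal R} :
    A.minorsIdeal t ≤ I ↔
      ∀ (f : Fin t → ι) (g : Fin t → κ), (A.submatrix f g).det ∈ I := by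
  simp [minorsIdeal, Ideal.span_le, Set.range_subset_iff]

theorem minorsIdeal_map (f : R →+* S) (A : Matrix ι κ R) (t : ℕ) :
    (A.map f).minorsIdeal t = (A.minorsIdeal t).map f := by
  rw [minorsIdeal, minorsIdeal, Ideal.map_span, ← Set.range_comp]
  congr 2
  ext fg
  simp [RingHom.map_det, submatrix_map]

theorem minorsIdeal_transpose (A : Matrix ι κ R) (t : ℕ) :
    Aᵀ.minorsIdeal t = A.minorsIdeal t := by
  apply le_antisymm <;> refine minorsIdeal_le_iff.2 fun f g ↦ ?_
  · rw [← transpose_submatrix, det_transpose]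
    exact det_submatrix_mem_minorsIdeal A g f
  · rw [← det_transpose, transpose_submatrix]
    exact det_submatrix_mem_minorsIdeal Aᵀ g f

theorem minorsIdeal_submatrix_le (A : Matrix ι κ R) (f : ι' → ι) (g : κ' → κ) (t : ℕ) :
    (A.submatrix f g).minorsIdeal t ≤ A.minorsIdeal t :=
  minorsIdeal_le_iff.2 fun f' g' ↦ det_submatrix_mem_minorsIdeal A (f ∘ f') (g ∘ g')

theorem minorsIdeal_submatrix_equiv (A : Matrix ι κ R) (f : ι' ≃ ι) (g : κ' ≃ κ) (t : ℕ) :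
    (A.submatrix f g).minorsIdeal t = A.minorsIdeal t := by
  refine le_antisymm (minorsIdeal_submatrix_le A f g t) ?_
  simpa using minorsIdeal_submatrix_le (A.submatrix f g) f.symm g.symm t

theorem minorsIdeal_mul_le_right [Fintype ι] (U : Matrix ι' ι R) (A : Matrix ι κ R) (t : ℕ) :
    (U * A).minorsIdeal t ≤ A.minorsIdeal t := by
  refine minorsIdeal_le_iff.2 fun f g ↦ ?_
  have key : ((U * A).submatrix f g).det =
      ∑ h : Fin t → ι, (∏ i, U (f i) (h i)) * (A.submatrix h g).det := by
    have hrow : (U * A).submatrix f g =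
        fun i ↦ ∑ j, U (f i) j • fun k ↦ A j (g k) := by
      ext i k
      simp [mul_apply]
    rw [hrow]
    refine ((detRowAlternating (n := Fin t) (R := R)).toMultilinearMap.map_sum
      (fun i j ↦ U (f i) j • fun k ↦ A j (g k))).trans (Finset.sum_congr rfl fun h _ ↦ ?_)
    exact (detRowAlternating (n := Fin t) (R := R)).toMultilinearMap.map_smul_univ
      (fun i ↦ U (f i) (h i)) (fun i k ↦ A (h i) (g k))
  rw [key]
  exact sum_mem fun h _ ↦ Ideal.mul_mem_left _ _ (det_submatrix_mem_minorsIdeal A h g)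

theorem minorsIdeal_mul_le_left [Fintype κ] (A : Matrix ι κ R) (V : Matrix κ κ' R) (t : ℕ) :
    (A * V).minorsIdeal t ≤ A.minorsIdeal t := by
  rw [← minorsIdeal_transpose, ← minorsIdeal_transpose A, transpose_mul]
  exact minorsIdeal_mul_le_right _ _ _

theorem minorsIdeal_mul_of_isUnit_left [Fintype ι] [DecidableEq ι] {U : Matrix ι ι R}
    (hU : IsUnit U) (A : Matrix ι κ R) (t : ℕ) :
    (U * A).minorsIdeal t = A.minorsIdeal t := by
  refine le_antisymm (minorsIdeal_mul_le_right U A t) ?_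
  obtain ⟨U, rfl⟩ := hU
  have h := minorsIdeal_mul_le_right (↑U⁻¹ : Matrix ι ι R) ((↑U : Matrix ι ι R) * A) t
  rwa [← Matrix.mul_assoc, Units.inv_mul, Matrix.one_mul] at h

theorem minorsIdeal_mul_of_isUnit_right [Fintype κ] [DecidableEq κ] {V : Matrix κ κ R}
    (hV : IsUnit V) (A : Matrix ι κ R) (t : ℕ) :
    (A * V).minorsIdeal t = A.minorsIdeal t := by
  rw [← minorsIdeal_transpose, ← minorsIdeal_transpose A, transpose_mul]
  exact minorsIdeal_mul_of_isUnit_left ((isUnit_transpose _).2 hV) _ _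

section Blocks

variable {α β : Type*} (a : Matrix α β R) (D : Matrix ι κ R)

theorem det_fromBlocks_submatrix_inr_mem {t : ℕ} (f : Fin t → ι) (g : Fin t → β ⊕ κ) :
    ((fromBlocks a 0 0 D).submatrix (Sum.inr ∘ f) g).det ∈ D.minorsIdeal t := by
  by_cases hg : ∃ j b, g j = Sum.inl b
  · obtain ⟨j, b, hj⟩ := hg
    rw [det_eq_zero_of_column_eq_zero j fun i ↦ by simp [hj]]
    exact zero_mem _
  · have hg' : ∀ j, ∃ k, g j = Sum.inr k := fun j ↦ by
      cases h : g j with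
      | inl b => exact (hg ⟨j, b, h⟩).elim
      | inr k => exact ⟨k, rfl⟩
    choose g' hg' using hg'
    obtain rfl : g = Sum.inr ∘ g' := funext hg'
    exact det_submatrix_mem_minorsIdeal D f g'

theorem minorsIdeal_fromBlocks_zero [Unique α] [Unique β]
    (ha : IsUnit (a default default)) (t : ℕ) :
    (fromBlocks a 0 0 D).minorsIdeal (t + 1) = D.minorsIdeal t := by
  apply le_antisymm
  · refine minorsIdeal_le_iff.2 fun f g ↦ ?_
    by_cases hf : Function.Injective f
    · obtain ⟨k, hk⟩ : ∃ k : Fin (t + 1), ∀ i, ∃ r, f (k.succAbove i) = Sum.inr r := by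
        by_cases h : ∃ k b, f k = Sum.inl b
        · obtain ⟨k, b, hk⟩ := h
          refine ⟨k, fun i ↦ ?_⟩
          cases h : f (k.succAbove i) with
          | inl c =>
            exact (Fin.succAbove_ne k i (hf (by rw [h, hk, Subsingleton.elim b c]))).elim
          | inr r => exact ⟨r, rfl⟩
        · refine ⟨0, fun i ↦ ?_⟩
          cases h' : f (Fin.succAbove 0 i) with
          | inl c => exact (h ⟨_, c, h'⟩).elim
          | inr r => exact ⟨r, rfl⟩
      choose f' hf' using hk
      rw [det_succ_row _ k]
      refine sum_mem fun j _ ↦ Ideal.mul_mem_left _ _ ?_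
      have hf'' : f ∘ k.succAbove = Sum.inr ∘ f' := funext hf'
      rw [submatrix_submatrix, hf'']
      exact det_fromBlocks_submatrix_inr_mem a D f' _
    · obtain ⟨i, j, hij, hne⟩ := Function.not_injective_iff.1 hf
      rw [det_zero_of_row_eq hne (by ext k; simp [hij])]
      exact zero_mem _
  · refine minorsIdeal_le_iff.2 fun f g ↦ ?_
    have h := det_submatrix_mem_minorsIdeal (fromBlocks a 0 0 D)
      (Fin.cons (Sum.inl default) (Sum.inr ∘ f) : Fin (t + 1) → α ⊕ ι)
      (Fin.cons (Sum.inl default) (Sum.inr ∘ g) : Fin (t + 1) → β ⊕ κ)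
    rw [det_succ_row_zero, Fin.sum_univ_succ] at h
    simp only [submatrix_apply, Fin.cons_zero, Fin.cons_succ, Function.comp_apply,
      fromBlocks_apply₁₁, fromBlocks_apply₁₂, zero_apply, mul_zero, zero_mul,
      Finset.sum_const_zero, add_zero, Fin.val_zero, pow_zero, one_mul, submatrix_submatrix] at h
    exact (Ideal.unit_mul_mem_iff_mem _ ha).1 h

end Blocks

/-- If a matrix has a unit entry, then row and column operations reduce its `(t + 1) × (t + 1)`
minors to the `t × t` minors of a matrix with one row and one column less. -/
theorem exists_minorsIdeal_succ_eq [Fintype ι] [Fintype κ] [DecidableEq ι] [DecidableEq κ]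
    (A : Matrix ι κ R) {i₀ : ι} {j₀ : κ} (h : IsUnit (A i₀ j₀)) :
    ∃ D : Matrix {i // ¬ i = i₀} {j // ¬ j = j₀} R,
      ∀ t, A.minorsIdeal (t + 1) = D.minorsIdeal t := by
  let e := Equiv.sumCompl (· = i₀)
  let e' := Equiv.sumCompl (· = j₀)
  let r : Unit ⊕ {i // ¬ i = i₀} ≃ ι :=
    (Equiv.sumCongr (Equiv.ofUnique Unit {i // i = i₀}) (Equiv.refl _)).trans e
  let c : Unit ⊕ {j // ¬ j = j₀} ≃ κ :=
    (Equiv.sumCongr (Equiv.ofUnique Unit {j // j = j₀}) (Equiv.refl _)).trans e'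
  let B := A.submatrix r c
  have hB : B.toBlocks₁₁ = diagonal fun _ ↦ A i₀ j₀ := by
    ext i j
    have hr : r (Sum.inl i) = i₀ := (Equiv.ofUnique Unit {i // i = i₀} i).2
    have hc : c (Sum.inl j) = j₀ := (Equiv.ofUnique Unit {j // j = j₀} j).2
    simp [B, toBlocks₁₁, hr, hc]
  have hunit : IsUnit B.toBlocks₁₁ := by
    rw [hB, isUnit_diagonal, Pi.isUnit_iff]
    exact fun _ ↦ h
  let := hunit.invertible
  refine ⟨B.toBlocks₂₂ - B.toBlocks₂₁ * ⅟B.toBlocks₁₁ * B.toBlocks₁₂, fun t ↦ ?_⟩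
  rw [← minorsIdeal_submatrix_equiv A r c]
  change B.minorsIdeal _ = _
  conv_lhs => rw [← fromBlocks_toBlocks B, fromBlocks_eq_of_invertible₁₁]
  rw [minorsIdeal_mul_of_isUnit_right, minorsIdeal_mul_of_isUnit_left,
    minorsIdeal_fromBlocks_zero]
  · rw [hB]
    simpa using h
  · simp [isUnit_iff_isUnit_det]
  · simp [isUnit_iff_isUnit_det]

/-- If all entries of a matrix but one lie in an ideal, so do its minors of size at least two. -/
theorem minorsIdeal_le_of_forall_ne {A : Matrix ι κ R} {I : Ideal R} {i₀ : ι} {j₀ : κ}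
    (h : ∀ i j, ¬ (i = i₀ ∧ j = j₀) → A i j ∈ I) (t : ℕ) : A.minorsIdeal (t + 2) ≤ I := by
  refine minorsIdeal_le_iff.2 fun f g ↦ ?_
  by_cases hf : Function.Injective f
  · obtain ⟨k, hk⟩ : ∃ k, f k ≠ i₀ := by
      by_contra! hall
      exact absurd (hf ((hall 0).trans (hall 1).symm)) (by simp)
    rw [det_succ_row _ k]
    exact sum_mem fun j _ ↦ Ideal.mul_mem_right _ _ <| Ideal.mul_mem_left _ _ <|
      h _ _ fun hk' ↦ hk hk'.1
  · obtain ⟨i, j, hij, hne⟩ := Function.not_injective_iff.1 hf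
    rw [det_zero_of_row_eq hne (by ext k; simp [hij])]
    exact zero_mem _

theorem minorsIdeal_one (A : Matrix ι κ R) :
    A.minorsIdeal 1 = Ideal.span (Set.range fun ij : ι × κ ↦ A ij.1 ij.2) := by
  apply le_antisymm
  · refine minorsIdeal_le_iff.2 fun f g ↦ Ideal.subset_span ⟨(f 0, g 0), ?_⟩
    simp
  · rw [Ideal.span_le, Set.range_subset_iff]
    rintro ⟨i, j⟩
    simpa using det_submatrix_mem_minorsIdeal A (fun _ : Fin 1 ↦ i) (fun _ ↦ j)

/-- The generic perturbation of a single entry: if `p` is minimal over the ideal of minors of `A`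
and contains all entries of `A`, then the extension of `p` to the polynomial ring is minimal over
the ideal of minors of size at least two of the matrix `A` with `X` added to one entry. -/
theorem map_C_mem_minimalPrimes_minorsIdeal [IsNoetherianRing R] [DecidableEq ι] [DecidableEq κ]
    (A : Matrix ι κ R) (t : ℕ) {p : Ideal R} (hp : p ∈ (A.minorsIdeal (t + 2)).minimalPrimes)
    (hA : ∀ i j, A i j ∈ p) (i₀ : ι) (j₀ : κ) :
    p.map (C : R →+* R[X]) ∈
      ((A.map C + single i₀ j₀ (X : R[X])).minorsIdeal (t + 2)).minimalPrimes := by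
  have := hp.isPrime
  set B := A.map C + single i₀ j₀ (X : R[X]) with hB
  have hf : Function.Surjective (constantCoeff : R[X] →+* R) := fun r ↦ ⟨C r, by simp⟩
  have hBA : B.map constantCoeff = A := by
    ext i j
    simp [hB, single_apply, apply_ite]
  have hcomap : (A.minorsIdeal (t + 2)).comap constantCoeff =
      Ideal.span (insert X (B.minorsIdeal (t + 2) : Set R[X])) := by
    rw [← hBA, minorsIdeal_map, Ideal.comap_map_of_surjective' _ hf, ker_constantCoeff,
      Ideal.span_insert, Ideal.span_eq, sup_comm]
  have hmin := Ideal.minimalPrimes_comap_of_surjective hf hp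
  rw [hcomap] at hmin
  have hX : (X : R[X]) ∉ p.map (C : R →+* R[X]) := fun h ↦ by
    have := (Ideal.mem_map_C_iff.1 h) 1
    simp at this
    exact hp.isPrime.ne_top ((Ideal.eq_top_iff_one _).2 this)
  have hlt : p.map (C : R →+* R[X]) < p.comap constantCoeff := by
    refine lt_of_le_of_ne (Ideal.map_le_iff_le_comap.2 fun x hx ↦ by simpa using hx) fun h ↦ hX ?_
    rw [h]
    simp
  have hle : B.minorsIdeal (t + 2) ≤ p.map C := by
    refine minorsIdeal_le_of_forall_ne (i₀ := i₀) (j₀ := j₀) (fun i j hij ↦ ?_) t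
    have : single i₀ j₀ (X : R[X]) i j = 0 := by
      rw [single_apply, if_neg]
      tauto
    simpa [hB, this] using Ideal.mem_map_of_mem C (hA i j)
  have := Ideal.mem_minimalPrimes_span_of_mem_minimalPrimes_span_insert hlt X _ hmin
    (B.minorsIdeal (t + 2)) hle
    fun x hx ↦ Ideal.le_radical (Ideal.subset_span (Set.mem_insert_of_mem _ hx))
  rwa [Ideal.span_eq] at this

end Matrix

theorem Ideal.height_le_height_map_C {R : Type*} [CommRing R] [IsNoetherianRing R] (p : Ideal R)
    [p.IsPrime] : p.height ≤ (p.map (C : R →+* R[X])).height := by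
  have : (p.map (C : R →+* R[X])).LiesOver p := ⟨by
    ext x
    simp [Ideal.under, Ideal.mem_map_C_iff, coeff_C, apply_ite]⟩
  rw [Ideal.height_eq_height_add_of_liesOver_of_hasGoingDown p (p.map (C : R →+* R[X]))]
  exact le_self_add

namespace Matrix

universe u v w

/-- The **Eagon–Northcott bound**: a minimal prime over the ideal of `(t + 1) × (t + 1)` minors of
a matrix over a Noetherian ring has height at most `(m - t) * (n - t)`. -/
theorem height_le_of_mem_minimalPrimes_minorsIdeal {R : Type u} [CommRing R] [IsNoetherianRing R]
    {ι : Type v} {κ : Type w} [Fintype ι] [Fintype κ] (A : Matrix ι κ R) (t : ℕ)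
    {p : Ideal R} (hp : p ∈ (A.minorsIdeal (t + 1)).minimalPrimes)
    (hι : t < Fintype.card ι) (hκ : t < Fintype.card κ) :
    p.height ≤ ((Fintype.card ι - t) * (Fintype.card κ - t) : ℕ) := by
  classical
  induction t generalizing R ι κ with
  | zero =>
    rw [minorsIdeal_one] at hp
    refine (Ideal.height_le_card_of_mem_minimalPrimes_span (Set.finite_range _) hp).trans ?_
    rw [← Set.image_univ]
    exact_mod_cast (Set.ncard_image_le Set.finite_univ).trans (by simp [Set.ncard_univ])
  | succ t ih =>
    have unit_case : ∀ {S : Type u} [CommRing S] [IsNoetherianRing S] (B : Matrix ι κ S)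
        {q : Ideal S}, q ∈ (B.minorsIdeal (t + 2)).minimalPrimes → ∀ i₀ j₀, B i₀ j₀ ∉ q →
        q.height ≤ ((Fintype.card ι - (t + 1)) * (Fintype.card κ - (t + 1)) : ℕ) := by
      intro S _ _ B q hq i₀ j₀ hB
      have := hq.isPrime
      let L := Localization.AtPrime q
      have hunit : IsUnit (B.map (algebraMap S L) i₀ j₀) :=
        IsLocalization.map_units L (⟨B i₀ j₀, hB⟩ : q.primeCompl)
      obtain ⟨D, hD⟩ := exists_minorsIdeal_succ_eq (B.map (algebraMap S L)) hunit
      have hmin : IsLocalRing.maximalIdeal L ∈ (D.minorsIdeal (t + 1)).minimalPrimes := by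
        rwa [← hD, minorsIdeal_map, IsLocalization.minimalPrimes_map q.primeCompl L,
          Set.mem_preimage, Localization.AtPrime.under_maximalIdeal]
      have hcι : Fintype.card {i // ¬ i = i₀} = Fintype.card ι - 1 := by simp
      have hcκ : Fintype.card {j // ¬ j = j₀} = Fintype.card κ - 1 := by simp
      have := ih D hmin (by omega) (by omega)
      rwa [← IsLocalization.height_under q.primeCompl, Localization.AtPrime.under_maximalIdeal,
        hcι, hcκ, Nat.sub_sub, Nat.sub_sub, add_comm 1 t] at this
    by_cases hA : ∀ i j, A i j ∈ p
    · have := hp.isPrime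
      obtain ⟨i₀⟩ : Nonempty ι := Fintype.card_pos_iff.1 (by omega)
      obtain ⟨j₀⟩ : Nonempty κ := Fintype.card_pos_iff.1 (by omega)
      refine p.height_le_height_map_C.trans
        (unit_case _ (map_C_mem_minimalPrimes_minorsIdeal A t hp hA i₀ j₀) i₀ j₀ fun h ↦ ?_)
      have h1 := Ideal.mem_map_C_iff.1 h 1
      simp at h1
      exact hp.isPrime.ne_top ((Ideal.eq_top_iff_one _).2 h1)
    · push Not at hA
      obtain ⟨i₀, j₀, h⟩ := hA
      exact unit_case A hp i₀ j₀ h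

end Matrix

theorem detIdeal_eq_minorsIdeal {R : Type*} [CommRing R] {m n : ℕ} (A : Matrix (Fin m) (Fin n) R)
    (t : ℕ) : detIdeal A (t : ℤ) = A.minorsIdeal t := by
  apply le_antisymm
  · rw [detIdeal, Ideal.span_le]
    rintro d ⟨f, g, -, -, rfl⟩
    exact A.det_submatrix_mem_minorsIdeal f g
  · refine Matrix.minorsIdeal_le_iff.2 fun f g ↦ ?_
    by_cases hf : Function.Injective f
    · by_cases hg : Function.Injective g
      · exact Ideal.subset_span ⟨f, g, hf, hg, rfl⟩
      · obtain ⟨i, j, hij, hne⟩ := Function.not_injective_iff.1 hg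
        rw [Matrix.det_zero_of_column_eq hne (by simp [hij])]
        exact zero_mem _
    · obtain ⟨i, j, hij, hne⟩ := Function.not_injective_iff.1 hf
      rw [Matrix.det_zero_of_row_eq hne (by ext k; simp [hij])]
      exact zero_mem _

/-- If `R` is a commutative Noetherian ring, `A` is an `m × n` matrix over `R`,
`1 ≤ t ≤ min m n`, and the determinantal ideal `I_t(A)` is proper, then every minimal
prime over `I_t(A)` has height at most `(m - t + 1) * (n - t + 1)`; in particular the
height of `I_t(A)` (the infimum of heights of primes containing it) is at most
`(m - t + 1) * (n - t + 1)`. -/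
theorem minimalPrimes_height_le_of_detIdeal_ne_top
    {R : Type*} [CommRing R] [IsNoetherianRing R]
    {m n : ℕ} (hm : 1 ≤ m) (hn : 1 ≤ n) (A : Matrix (Fin m) (Fin n) R)
    (t : ℕ) (ht1 : 1 ≤ t) (ht2 : t ≤ min m n)
    (hproper : detIdeal A (t : ℤ) ≠ ⊤) :
    (∀ p : PrimeSpectrum R, p.asIdeal ∈ (detIdeal A (t : ℤ)).minimalPrimes →
        Order.height p ≤ ((m - t + 1) * (n - t + 1) : ℕ)) ∧
      (⨅ (p : PrimeSpectrum R) (_ : detIdeal A (t : ℤ) ≤ p.asIdeal), Order.height p) ≤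
        ((m - t + 1) * (n - t + 1) : ℕ) := by
  have key : ∀ p : PrimeSpectrum R, p.asIdeal ∈ (detIdeal A (t : ℤ)).minimalPrimes →
      Order.height p ≤ ((m - t + 1) * (n - t + 1) : ℕ) := by
    intro p hp
    obtain ⟨s, rfl⟩ : ∃ s, t = s + 1 := ⟨t - 1, by omega⟩
    rw [detIdeal_eq_minorsIdeal] at hp
    have h := Matrix.height_le_of_mem_minimalPrimes_minorsIdeal A s hp
      (by simp; omega) (by simp; omega)
    rw [← PrimeSpectrum.height_eq_orderHeight]
    simp only [Fintype.card_fin] at h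
    rwa [show m - (s + 1) + 1 = m - s by omega, show n - (s + 1) + 1 = n - s by omega]
  refine ⟨key, ?_⟩
  obtain ⟨p, hp⟩ := Ideal.nonempty_minimalPrimes hproper
  exact (iInf₂_le (⟨p, hp.isPrime⟩ : PrimeSpectrum R) hp.1.2).trans (key ⟨p, hp.isPrime⟩ hp)
end

section
/- Let R be a Noetherian Cohen–Macaulay local ring, let m, n ≥ 1, let A be an m×n matrix over R, and let t be an integer with 1 ≤ t ≤ min(m,n). Suppose the determinantal ideal I_t(A) is a proper ideal whose height equals (m − t + 1)(n − t + 1). Then the quotient ring R/I_t(A) is a Cohen–Macaulay local ring. -/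
/-- The depth of an ideal `I` in a commutative ring `R`: the supremum of the lengths of
regular sequences on `R` all of whose entries lie in `I`. -/
noncomputable def idealDepth {R : Type*} [CommRing R] (I : Ideal R) : ℕ∞ :=
  ⨆ (rs : List R) (_ : (∀ x ∈ rs, x ∈ I) ∧ RingTheory.Sequence.IsRegular R rs),
    (rs.length : ℕ∞)

/-- A commutative ring is a Cohen–Macaulay local ring if it is local and its depth (the
depth of its maximal ideal) equals its Krull dimension. -/
def IsCMLocalRing (R : Type*) [CommRing R] : Prop :=
  IsLocalRing R ∧ ∀ M : Ideal R, M.IsMaximal → (idealDepth M : WithBot ℕ∞) = ringKrullDim R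

namespace DetCM

section Homological

open CategoryTheory Abelian RingTheory.Sequence

universe u

variable {A : Type u} [CommRing A]

/-- Vanishing of `Ext^i(A ⧸ J, N)` for all `i < n`; over a Noetherian ring, and for `N` finitely
generated with `J N ≠ N`, this says that the `J`-depth of `N` is at least `n`. -/
def ExtVanish (J : Ideal A) (N : Type u) [AddCommGroup N] [Module A N] (n : ℕ) : Prop :=
  ∀ i < n, Subsingleton (Ext (ModuleCat.of A (A ⧸ J)) (ModuleCat.of A N) i)

variable {J : Ideal A} {N N₁ N₂ N₃ : Type u} [AddCommGroup N] [Module A N]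
  [AddCommGroup N₁] [Module A N₁] [AddCommGroup N₂] [Module A N₂] [AddCommGroup N₃] [Module A N₃]

lemma ExtVanish.mono {a b : ℕ} (h : ExtVanish J N b) (hab : a ≤ b) : ExtVanish J N a :=
  fun i hi => h i (hi.trans_le hab)

/-- The short complex of modules attached to an exact pair of linear maps. -/
abbrev exactComplex (f : N₁ →ₗ[A] N₂) (g : N₂ →ₗ[A] N₃) (hfg : Function.Exact f g) :
    ShortComplex (ModuleCat.{u} A) :=
  ShortComplex.mk (ModuleCat.ofHom f) (ModuleCat.ofHom g)
    (by rw [← ModuleCat.ofHom_comp, hfg.linearMap_comp_eq_zero]; rfl)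

lemma exactComplex_shortExact (f : N₁ →ₗ[A] N₂) (g : N₂ →ₗ[A] N₃) (hf : Function.Injective f)
    (hg : Function.Surjective g) (hfg : Function.Exact f g) :
    (exactComplex f g hfg).ShortExact :=
  ModuleCat.shortComplex_shortExact _ hfg hf hg

lemma ExtVanish.middle {n : ℕ} {f : N₁ →ₗ[A] N₂} {g : N₂ →ₗ[A] N₃} (hf : Function.Injective f)
    (hg : Function.Surjective g) (hfg : Function.Exact f g)
    (h₁ : ExtVanish J N₁ n) (h₃ : ExtVanish J N₃ n) : ExtVanish J N₂ n := by
  intro i hi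
  have hS := exactComplex_shortExact f g hf hg hfg
  have := h₁ i hi
  have := h₃ i hi
  refine subsingleton_of_forall_eq 0 fun x => ?_
  obtain ⟨y, rfl⟩ := Ext.covariant_sequence_exact₂ _ hS x (Subsingleton.elim _ _)
  rw [Subsingleton.elim y 0, Ext.zero_comp]

lemma ExtVanish.left {n : ℕ} {f : N₁ →ₗ[A] N₂} {g : N₂ →ₗ[A] N₃} (hf : Function.Injective f)
    (hg : Function.Surjective g) (hfg : Function.Exact f g)
    (h₂ : ExtVanish J N₂ n) (h₃ : ExtVanish J N₃ (n - 1)) : ExtVanish J N₁ n := by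
  intro i hi
  have hS := exactComplex_shortExact f g hf hg hfg
  have := h₂ i hi
  refine subsingleton_of_forall_eq 0 fun x => ?_
  cases i with
  | zero =>
    have := hS.mono_f
    exact Ext.postcomp_mk₀_injective_of_mono _ (exactComplex f g hfg).f (Subsingleton.elim _ _)
  | succ i =>
    have := h₃ i (by omega)
    obtain ⟨y, rfl⟩ := Ext.covariant_sequence_exact₁ _ hS x (Subsingleton.elim _ _) rfl
    rw [Subsingleton.elim y 0, Ext.zero_comp]

lemma ExtVanish.right {n : ℕ} {f : N₁ →ₗ[A] N₂} {g : N₂ →ₗ[A] N₃} (hf : Function.Injective f)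
    (hg : Function.Surjective g) (hfg : Function.Exact f g)
    (h₁ : ExtVanish J N₁ (n + 1)) (h₂ : ExtVanish J N₂ n) : ExtVanish J N₃ n := by
  intro i hi
  have hS := exactComplex_shortExact f g hf hg hfg
  have := h₂ i hi
  have := h₁ (i + 1) (by omega)
  refine subsingleton_of_forall_eq 0 fun x => ?_
  obtain ⟨y, rfl⟩ := Ext.covariant_sequence_exact₃ _ hS x rfl (Subsingleton.elim _ _)
  rw [Subsingleton.elim y 0, Ext.zero_comp]

/-- Dividing by a nonzerodivisor of `J` drops the depth by at most one. -/
lemma ExtVanish.of_smulRegular {n : ℕ} {x : A} (hx : x ∈ J) {g : N →ₗ[A] N₃}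
    (hreg : IsSMulRegular N x) (hg : Function.Surjective g)
    (hfg : Function.Exact (LinearMap.lsmul A N x) g)
    (h₃ : ExtVanish J N₃ n) : ExtVanish J N (n + 1) := by
  intro i hi
  have hS := exactComplex_shortExact (LinearMap.lsmul A N x) g hreg hg hfg
  refine subsingleton_of_forall_eq 0 fun y => ?_
  have hzero : y.comp (Ext.mk₀ (exactComplex (LinearMap.lsmul A N x) g hfg).f)
      (add_zero i) = 0 := by
    have hann : x ∈ Module.annihilator A (ModuleCat.of A (A ⧸ J)) := by
      change x ∈ Module.annihilator A (A ⧸ J)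
      rwa [Ideal.annihilator_quotient]
    have := Ext.postcomp_smul_id_eq_zero_of_mem_annihilator (M := ModuleCat.of A N) hann i
    have := congrArg (fun φ => φ.hom y) this
    exact this
  cases i with
  | zero =>
    have := hS.mono_f
    refine Ext.postcomp_mk₀_injective_of_mono _
      (exactComplex (LinearMap.lsmul A N x) g hfg).f ?_
    rw [map_zero]
    exact hzero
  | succ i =>
    have := h₃ i (by omega)
    obtain ⟨z, rfl⟩ := Ext.covariant_sequence_exact₁ _ hS y hzero rfl
    rw [Subsingleton.elim z 0, Ext.zero_comp]

/-- The canonical linear map between quotients by nested ideals. -/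
noncomputable abbrev quotFactor {I₁ I₂ : Ideal A} (h : I₁ ≤ I₂) : (A ⧸ I₁) →ₗ[A] (A ⧸ I₂) :=
  (Ideal.Quotient.factorₐ A h).toLinearMap

lemma quotFactor_mk {I₁ I₂ : Ideal A} (h : I₁ ≤ I₂) (x : A) :
    quotFactor h (Ideal.Quotient.mk I₁ x) = Ideal.Quotient.mk I₂ x := rfl

lemma ExtVanish.quotient_inf {I₁ I₂ : Ideal A} {n : ℕ} (h₁ : ExtVanish J (A ⧸ I₁) n)
    (h₂ : ExtVanish J (A ⧸ I₂) n) (h₃ : ExtVanish J (A ⧸ (I₁ ⊔ I₂)) (n - 1)) :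
    ExtVanish J (A ⧸ (I₁ ⊓ I₂)) n := by
  have hprod : ExtVanish J ((A ⧸ I₁) × (A ⧸ I₂)) n :=
    ExtVanish.middle (f := LinearMap.inl A _ _) (g := LinearMap.snd A _ _)
      LinearMap.inl_injective LinearMap.snd_surjective .inl_snd h₁ h₂
  refine ExtVanish.left
    (f := (quotFactor (inf_le_left : I₁ ⊓ I₂ ≤ I₁)).prod
      (quotFactor (inf_le_right : I₁ ⊓ I₂ ≤ I₂)))
    (g := (quotFactor (le_sup_left : I₁ ≤ I₁ ⊔ I₂)).coprod
      (-quotFactor (le_sup_right : I₂ ≤ I₁ ⊔ I₂))) ?_ ?_ ?_ hprod h₃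
  · rw [injective_iff_map_eq_zero]
    intro x hx
    obtain ⟨x, rfl⟩ := Ideal.Quotient.mk_surjective x
    have h := Prod.ext_iff.mp hx
    exact Ideal.Quotient.eq_zero_iff_mem.mpr
      ⟨Ideal.Quotient.eq_zero_iff_mem.mp h.1, Ideal.Quotient.eq_zero_iff_mem.mp h.2⟩
  · intro x
    obtain ⟨x, rfl⟩ := Ideal.Quotient.mk_surjective x
    exact ⟨(Ideal.Quotient.mk _ x, 0), by
      rw [LinearMap.coprod_apply, map_zero, add_zero, quotFactor_mk]⟩
  · rintro ⟨a, b⟩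
    obtain ⟨a, rfl⟩ := Ideal.Quotient.mk_surjective a
    obtain ⟨b, rfl⟩ := Ideal.Quotient.mk_surjective b
    rw [LinearMap.coprod_apply, LinearMap.neg_apply, quotFactor_mk, quotFactor_mk,
      ← sub_eq_add_neg, ← map_sub, Ideal.Quotient.eq_zero_iff_mem]
    constructor
    · intro h
      obtain ⟨y, hy, z, hz, hyz⟩ := Submodule.mem_sup.mp h
      refine ⟨Ideal.Quotient.mk _ (a - y), ?_⟩
      rw [LinearMap.prod_apply, Function.prod, quotFactor_mk, quotFactor_mk]
      refine Prod.ext (Ideal.Quotient.eq.mpr ?_) (Ideal.Quotient.eq.mpr ?_)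
      · simpa using hy
      · have : a - y - b = z := by rw [sub_eq_iff_eq_add]; linear_combination -hyz
        rwa [this]
    · rintro ⟨y, hy⟩
      obtain ⟨y, rfl⟩ := Ideal.Quotient.mk_surjective y
      have h := Prod.ext_iff.mp hy
      have := Submodule.sub_mem _
        (Submodule.mem_sup_right (Ideal.Quotient.eq.mp h.2) : y - b ∈ I₁ ⊔ I₂)
        (Submodule.mem_sup_left (Ideal.Quotient.eq.mp h.1))
      simpa using this

lemma quotFactor_surjective {I₁ I₂ : Ideal A} (h : I₁ ≤ I₂) :
    Function.Surjective (quotFactor h) := by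
  intro a
  obtain ⟨a, rfl⟩ := Ideal.Quotient.mk_surjective a
  exact ⟨Ideal.Quotient.mk _ a, rfl⟩

lemma isSMulRegular_quotient {I : Ideal A} {x : A} (hreg : ∀ a, x * a ∈ I → a ∈ I) :
    IsSMulRegular (A ⧸ I) x := by
  rw [isSMulRegular_iff_right_eq_zero_of_smul]
  intro a ha
  obtain ⟨a, rfl⟩ := Ideal.Quotient.mk_surjective a
  exact Ideal.Quotient.eq_zero_iff_mem.mpr (hreg a (Ideal.Quotient.eq_zero_iff_mem.mp ha))

lemma exact_lsmul_quotFactor (I : Ideal A) (x : A) :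
    Function.Exact (LinearMap.lsmul A (A ⧸ I) x)
      (quotFactor (le_sup_left : I ≤ I ⊔ Ideal.span {x})) := by
  intro a
  obtain ⟨a, rfl⟩ := Ideal.Quotient.mk_surjective a
  rw [quotFactor_mk, Ideal.Quotient.eq_zero_iff_mem]
  constructor
  · intro h
    obtain ⟨y, hy, z, hz, rfl⟩ := Submodule.mem_sup.mp h
    obtain ⟨c, rfl⟩ := Ideal.mem_span_singleton'.mp hz
    refine ⟨Ideal.Quotient.mk _ c, Ideal.Quotient.eq.mpr ?_⟩
    have : x • c - (y + c * x) = -y := by rw [smul_eq_mul]; ring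
    rw [this]
    exact neg_mem hy
  · rintro ⟨c, hc⟩
    obtain ⟨c, rfl⟩ := Ideal.Quotient.mk_surjective c
    have hc : x • c - a ∈ I := Ideal.Quotient.eq.mp hc
    have := Submodule.sub_mem _ (Submodule.mem_sup_right
      (Ideal.mul_mem_left _ c (Ideal.mem_span_singleton_self x)) : c * x ∈ I ⊔ Ideal.span {x})
      (Submodule.mem_sup_left hc)
    have h2 : c * x - (x • c - a) = a := by rw [smul_eq_mul]; ring
    rwa [h2] at this

lemma ExtVanish.quotient_of_regular {I : Ideal A} {n : ℕ} {x : A} (hx : x ∈ J)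
    (hreg : ∀ a, x * a ∈ I → a ∈ I) (h : ExtVanish J (A ⧸ (I ⊔ Ideal.span {x})) n) :
    ExtVanish J (A ⧸ I) (n + 1) :=
  ExtVanish.of_smulRegular hx (isSMulRegular_quotient hreg) (quotFactor_surjective _)
    (exact_lsmul_quotFactor I x) h

lemma ExtVanish.quotient_sup_of_regular {I : Ideal A} {n : ℕ} {x : A}
    (hreg : ∀ a, x * a ∈ I → a ∈ I) (h : ExtVanish J (A ⧸ I) (n + 1)) :
    ExtVanish J (A ⧸ (I ⊔ Ideal.span {x})) n :=
  ExtVanish.right (f := LinearMap.lsmul A (A ⧸ I) x) (g := quotFactor le_sup_left)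
    (isSMulRegular_quotient hreg) (quotFactor_surjective _) (exact_lsmul_quotFactor I x) h
    (h.mono n.le_succ)

end Homological

section PosetInduction

universe u

variable {A : Type u} [CommRing A] {J : Ideal A}
  {Δ : Type*} [Lattice Δ] [IsUpperModularLattice Δ] [OrderTop Δ] [Finite Δ]

/-- If the elements `p c` behave like the generators of an algebra with straightening law on the
upper semimodular lattice `Δ`, then the depth of the quotient by the elements not above `c` is
at least the depth of the quotient by all of them plus the corank of `c`. -/
theorem extVanish_of_straightening (p : Δ → A) (r : Δ → ℕ) (d : ℕ)
    (hinf : ∀ Ω₁ Ω₂ : Set Δ, IsLowerSet Ω₁ → IsLowerSet Ω₂ → ⊤ ∉ Ω₁ → ⊤ ∉ Ω₂ →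
      Ideal.span (p '' Ω₁) ⊓ Ideal.span (p '' Ω₂) ≤ Ideal.span (p '' (Ω₁ ∩ Ω₂)))
    (hreg : ∀ c : Δ, c ≠ ⊤ → ∀ a, p c * a ∈ Ideal.span (p '' {x | ¬ c ≤ x}) →
      a ∈ Ideal.span (p '' {x | ¬ c ≤ x}))
    (hmem : ∀ c : Δ, c ≠ ⊤ → p c ∈ J)
    (hr : ∀ a b : Δ, a ⋖ b → r a = r b + 1) (hr0 : r ⊤ = 0)
    (hbase : ExtVanish J (A ⧸ Ideal.span (p '' {x | ¬ ⊤ ≤ x})) d) (c : Δ) :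
    ExtVanish J (A ⧸ Ideal.span (p '' {x | ¬ c ≤ x})) (d + r c) := by
  classical
  suffices H : ∀ c : Δ, ExtVanish J (A ⧸ Ideal.span (p '' {x | ¬ c ≤ x})) (d + r c) ∧
      ∀ S : Finset Δ, S.Nonempty → (∀ s ∈ S, c ⋖ s) →
        ExtVanish J (A ⧸ Ideal.span (p '' {x | ∀ s ∈ S, ¬ s ≤ x})) (d + r c - 1) from (H c).1
  intro c
  induction c using WellFoundedGT.induction with
  | ind c ih =>
  have hS : ∀ S : Finset Δ, S.Nonempty → (∀ s ∈ S, c ⋖ s) →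
      ExtVanish J (A ⧸ Ideal.span (p '' {x | ∀ s ∈ S, ¬ s ≤ x})) (d + r c - 1) := by
    intro S hS
    induction hS using Finset.Nonempty.cons_induction with
    | singleton s =>
      intro h
      have hcs := h s (by simp)
      have h1 := (ih s hcs.lt).1
      have hset : {x | ∀ y ∈ ({s} : Finset Δ), ¬ y ≤ x} = {x | ¬ s ≤ x} := by
        ext x
        simp
      rwa [hset, hr c s hcs, ← add_assoc, Nat.add_sub_cancel]
    | cons s S hs hne ihS =>
      intro h
      have hcs := h s (by simp)
      have hS' : ∀ s' ∈ S, c ⋖ s' := fun s' hs' => h s' (by simp [hs'])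
      have h1 := (ih s hcs.lt).1
      have h2 := ihS hS'
      have h3 := (ih s hcs.lt).2 (S.image (s ⊔ ·)) (hne.image _) (by
        intro x hx
        obtain ⟨s', hs', rfl⟩ := Finset.mem_image.mp hx
        have hne' : s ≠ s' := by rintro rfl; exact hs hs'
        have hinf' : s ⊓ s' = c := by
          refine le_antisymm ?_ (le_inf hcs.le (hS' s' hs').le)
          by_contra hcon
          have hlt : c < s ⊓ s' := lt_of_le_not_ge (le_inf hcs.le (hS' s' hs').le) hcon
          have e1 : s ⊓ s' = s := hcs.eq_or_eq hlt.le inf_le_left |>.resolve_left hlt.ne'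
          have e2 : s ⊓ s' = s' := (hS' s' hs').eq_or_eq hlt.le inf_le_right
            |>.resolve_left hlt.ne'
          exact hne' (e1.symm.trans e2)
        refine covBy_sup_of_inf_covBy_right ?_
        rw [hinf']
        exact hS' s' hs')
      have hrc := hr c s hcs
      have e1 : d + r c - 1 = d + r s := by omega
      rw [e1] at h2 ⊢
      have hsup : Ideal.span (p '' {x | ¬ s ≤ x}) ⊔ Ideal.span (p '' {x | ∀ s ∈ S, ¬ s ≤ x}) =
          Ideal.span (p '' {x | ∀ y ∈ S.image (s ⊔ ·), ¬ y ≤ x}) := by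
        rw [← Ideal.span_union, ← Set.image_union]
        congr 2
        ext x
        simp only [Set.mem_union, Set.mem_ofPred_eq, Finset.mem_image, forall_exists_index,
          and_imp, forall_apply_eq_imp_iff₂, sup_le_iff, not_and]
        tauto
      rw [← hsup] at h3
      have h4 := ExtVanish.quotient_inf h1 h2 h3
      have hI : Ideal.span (p '' {x | ¬ s ≤ x}) ⊓ Ideal.span (p '' {x | ∀ s ∈ S, ¬ s ≤ x}) =
          Ideal.span (p '' {x | ∀ y ∈ Finset.cons s S hs, ¬ y ≤ x}) := by
        have hset : {x | ∀ y ∈ Finset.cons s S hs, ¬ y ≤ x} =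
            {x | ¬ s ≤ x} ∩ {x | ∀ s ∈ S, ¬ s ≤ x} := by
          ext x
          simp
        rw [hset]
        refine le_antisymm (hinf _ _ ?_ ?_ ?_ ?_) (le_inf ?_ ?_)
        · exact fun a b hab ha hb => ha (hb.trans hab)
        · exact fun a b hab ha s hs hb => ha s hs (hb.trans hab)
        · simp
        · obtain ⟨s', hs'⟩ := hne
          exact fun h => h s' hs' le_top
        · exact Ideal.span_mono (Set.image_mono Set.inter_subset_left)
        · exact Ideal.span_mono (Set.image_mono Set.inter_subset_right)
      rwa [hI] at h4
  refine ⟨?_, hS⟩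
  rcases eq_or_ne c ⊤ with rfl | hc
  · rwa [hr0]
  · have := Fintype.ofFinite Δ
    obtain ⟨s, hs, -⟩ := exists_covBy_le_of_lt (lt_top_iff_ne_top.mpr hc)
    have h1 := hS (Finset.univ.filter (c ⋖ ·)) ⟨s, by simpa using hs⟩ (by simp)
    have hI : Ideal.span (p '' {x | ¬ c ≤ x}) ⊔ Ideal.span {p c} =
        Ideal.span (p '' {x | ∀ s ∈ Finset.univ.filter (c ⋖ ·), ¬ s ≤ x}) := by
      rw [← Set.image_singleton, ← Ideal.span_union, ← Set.image_union]
      congr 2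
      ext x
      simp only [Set.union_singleton, Set.mem_insert_iff, Set.mem_ofPred_eq, Finset.mem_filter,
        Finset.mem_univ, true_and]
      constructor
      · rintro (rfl | h) s hs hsx
        · exact hs.lt.not_ge hsx
        · exact h (hs.le.trans hsx)
      · intro h
        by_contra! hcon
        obtain ⟨s, hs, hsx⟩ := exists_covBy_le_of_lt (lt_of_le_of_ne hcon.2 hcon.1.symm)
        exact h s hs hsx
    rw [← hI] at h1
    have h2 := ExtVanish.quotient_of_regular (hmem c hc) (hreg c hc) h1
    have hrc := hr c s hs
    have e : d + r c - 1 + 1 = d + r c := by omega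
    rwa [e] at h2

end PosetInduction

section Straightening

open Submodule

variable {Δ : Type*} [PartialOrder Δ] {A : Type*} [CommRing A]

/-- A standard multiset: its elements form a chain. -/
def IsStd (s : Multiset Δ) : Prop := IsChain (· ≤ ·) {x | x ∈ s}

lemma IsStd.mono {s t : Multiset Δ} (ht : IsStd t) (h : ∀ x ∈ s, x ∈ t) : IsStd s :=
  IsChain.mono h ht

lemma IsStd.cons {s : Multiset Δ} (hs : IsStd s) {c : Δ} (h : ∀ x ∈ s, c ≤ x) :
    IsStd (c ::ₘ s) := by
  have : {x | x ∈ c ::ₘ s} = insert c {x | x ∈ s} := by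
    ext x
    simp
  rw [IsStd, this]
  exact IsChain.insert hs fun x hx _ => Or.inl (h x hx)

lemma IsStd.exists_min [Finite Δ] {s : Multiset Δ} (hs : IsStd s) (h0 : s ≠ 0) :
    ∃ b ∈ s, ∀ x ∈ s, b ≤ x := by
  classical
  obtain ⟨y, hy⟩ := Multiset.exists_mem_of_ne_zero h0
  obtain ⟨b, hb⟩ := Set.Finite.exists_minimal (s := {x | x ∈ s}) (Set.toFinite _) ⟨y, hy⟩
  refine ⟨b, hb.1, fun x hx => ?_⟩
  rcases hs.total hb.1 hx with h | h
  · exact h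
  · exact hb.2 hx h

/-- The straightening law: the product of two elements, the first of which is not below the
second, can be rewritten with a smaller first factor. -/
def Straightens (p : Δ → A) : Prop :=
  ∀ a b : Δ, ¬ a ≤ b → p a * p b ∈ AddSubgroup.closure {x | ∃ a' c, a' < a ∧ x = p a' * p c}

lemma mul_mem_closure {S T : Set A} {x y : A} (hx : x ∈ AddSubgroup.closure S)
    (h : ∀ z ∈ S, z * y ∈ AddSubgroup.closure T) : x * y ∈ AddSubgroup.closure T := by
  induction hx using AddSubgroup.closure_induction with
  | mem z hz => exact h z hz
  | zero => rw [zero_mul]; exact zero_mem _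
  | add a b _ _ ha hb => rw [add_mul]; exact add_mem ha hb
  | neg a _ ha => rw [neg_mul]; exact neg_mem ha

theorem Straightens.prod_mem [Finite Δ] {p : Δ → A} (hp : Straightens p) (s : Multiset Δ) (d : Δ)
    (hd : d ∈ s) :
    (s.map p).prod ∈ AddSubgroup.closure
      {x | ∃ t : Multiset Δ, IsStd t ∧ (∃ e ∈ t, e ≤ d) ∧ x = (t.map p).prod} := by
  classical
  suffices H : ∀ k : ℕ, ∀ d : Δ, ∀ l : Multiset Δ, l.card = k → p d * (l.map p).prod ∈
      AddSubgroup.closure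
      {x | ∃ t : Multiset Δ, t.card = k + 1 ∧ IsStd t ∧ (∃ e ∈ t, e ≤ d) ∧
        x = (t.map p).prod} by
    have := H _ d (s.erase d) rfl
    rw [← Multiset.prod_cons, ← Multiset.map_cons, Multiset.cons_erase hd] at this
    refine AddSubgroup.closure_mono ?_ this
    rintro _ ⟨t, -, h⟩
    exact ⟨t, h⟩
  intro k
  induction k with
  | zero =>
    intro d l hl
    rw [Multiset.card_eq_zero] at hl
    subst hl
    refine AddSubgroup.subset_closure ⟨{d}, by simp, ?_, ⟨d, by simp, le_rfl⟩, by simp⟩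
    simp [IsStd]
  | succ k ihk =>
    intro d
    induction d using WellFoundedLT.induction with
    | ind d ihd =>
    intro l hl
    obtain ⟨c, l, rfl⟩ : ∃ c l', l = c ::ₘ l' := by
      obtain ⟨c, hc⟩ := Multiset.exists_mem_of_ne_zero (s := l) (by rintro rfl; simp at hl)
      exact ⟨c, l.erase c, (Multiset.cons_erase hc).symm⟩
    have hl' : l.card = k := by simpa using hl
    rw [Multiset.map_cons, Multiset.prod_cons, mul_comm]
    refine mul_mem_closure (ihk c l hl') ?_
    rintro _ ⟨t, ht, hstd, -, rfl⟩
    obtain ⟨b, hb, hmin⟩ := hstd.exists_min (by rintro rfl; simp at ht)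
    by_cases hdb : d ≤ b
    · refine AddSubgroup.subset_closure ⟨d ::ₘ t, by simp [ht], hstd.cons
        fun x hx => hdb.trans (hmin x hx), ⟨d, by simp, le_rfl⟩, ?_⟩
      rw [Multiset.map_cons, Multiset.prod_cons, mul_comm]
    · obtain ⟨u, rfl⟩ : ∃ u, t = b ::ₘ u := ⟨_, (Multiset.cons_erase hb).symm⟩
      have e : ((b ::ₘ u).map p).prod * p d = (p d * p b) * (u.map p).prod := by
        rw [Multiset.map_cons, Multiset.prod_cons]; ring
      rw [e]
      refine mul_mem_closure (hp d b hdb) ?_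
      rintro _ ⟨a', c', hlt, rfl⟩
      have := ihd a' hlt (c' ::ₘ u) (by simpa using ht)
      rw [Multiset.map_cons, Multiset.prod_cons, ← mul_assoc] at this
      refine AddSubgroup.closure_mono ?_ this
      rintro _ ⟨t', h1, h2, ⟨e, he, hea⟩, h3⟩
      exact ⟨t', h1, h2, ⟨e, he, hea.trans hlt.le⟩, h3⟩

variable [OrderTop Δ]

variable (Δ) in
/-- The index type of standard monomials: chains with repetitions avoiding the top element. -/
abbrev StdIdx : Type _ := {s : Multiset Δ // IsStd s ∧ ⊤ ∉ s}

/-- The standard monomial of a chain. -/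
def stdMon (p : Δ → A) (s : StdIdx Δ) : A := (s.1.map p).prod

/-- Standard monomials having a factor in `Ω`. -/
def meets (Ω : Set Δ) : Set (StdIdx Δ) := {s | ∃ e ∈ s.1, e ∈ Ω}

variable {R : Type*} [CommRing R] [Algebra R A] {p : Δ → A}

lemma exists_stdIdx (htop : p ⊤ = 1) (t : Multiset Δ) (ht : IsStd t) :
    ∃ s : StdIdx Δ, (∀ x, x ∈ s.1 ↔ x ∈ t ∧ x ≠ ⊤) ∧ stdMon p s = (t.map p).prod := by
  classical
  refine ⟨⟨t.filter (· ≠ ⊤), ht.mono fun x hx => (Multiset.mem_filter.mp hx).1, by simp⟩,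
    fun x => Multiset.mem_filter, ?_⟩
  rw [stdMon]
  conv_rhs => rw [← Multiset.filter_add_not (· ≠ ⊤) t, Multiset.map_add, Multiset.prod_add]
  rw [Multiset.prod_eq_one (s := (t.filter fun a => ¬ a ≠ ⊤).map p), mul_one]
  intro x hx
  obtain ⟨y, hy, rfl⟩ := Multiset.mem_map.mp hx
  rw [not_not.mp (Multiset.mem_filter.mp hy).2, htop]

variable [Finite Δ]

lemma prod_mem_span_meets (hp : Straightens p) (htop : p ⊤ = 1) {Ω : Set Δ} (hΩ : IsLowerSet Ω)
    (hΩt : ⊤ ∉ Ω) (s : Multiset Δ) (hs : ∃ d ∈ s, d ∈ Ω) :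
    (s.map p).prod ∈ span R (stdMon p '' meets Ω) := by
  obtain ⟨d, hd, hdΩ⟩ := hs
  have := hp.prod_mem s d hd
  refine (AddSubgroup.closure_le (span R (stdMon p '' meets Ω)).toAddSubgroup).mpr ?_ this
  rintro _ ⟨t, ht, ⟨e, he, hed⟩, rfl⟩
  obtain ⟨s', hs', h⟩ := exists_stdIdx htop t ht
  refine subset_span ⟨s', ⟨e, (hs' e).mpr ⟨he, ?_⟩, hΩ hed hdΩ⟩, h⟩
  rintro rfl
  exact hΩt (hΩ hed hdΩ)

lemma prod_mem_span_stdMon (hp : Straightens p) (htop : p ⊤ = 1) (s : Multiset Δ) :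
    (s.map p).prod ∈ span R (Set.range (stdMon p)) := by
  have := hp.prod_mem (⊤ ::ₘ s) ⊤ (by simp)
  rw [Multiset.map_cons, Multiset.prod_cons, htop, one_mul] at this
  refine (AddSubgroup.closure_le (span R (Set.range (stdMon p))).toAddSubgroup).mpr ?_ this
  rintro _ ⟨t, ht, -, rfl⟩
  obtain ⟨s', -, h⟩ := exists_stdIdx htop t ht
  exact subset_span ⟨s', h⟩

lemma span_stdMon_eq_top (hp : Straightens p) (htop : p ⊤ = 1)
    (hgen : Algebra.adjoin R (Set.range p) = ⊤) : ⊤ ≤ span R (Set.range (stdMon p)) := by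
  rw [← Algebra.top_toSubmodule, ← hgen, Algebra.adjoin_eq_span]
  refine span_le.mpr fun x hx => ?_
  induction hx using Submonoid.closure_induction_left with
  | one => simpa using prod_mem_span_stdMon (R := R) hp htop 0
  | mul_left x hx y _ hy =>
    obtain ⟨c, rfl⟩ := hx
    have : span R (Set.range (stdMon p)) ≤
        (span R (Set.range (stdMon p))).comap (LinearMap.mulLeft R (p c)) := by
      refine span_le.mpr ?_
      rintro _ ⟨s, rfl⟩
      have := prod_mem_span_stdMon (R := R) hp htop (c ::ₘ s.1)
      rwa [Multiset.map_cons, Multiset.prod_cons] at this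
    exact this hy

lemma mem_ideal_span_iff (hp : Straightens p) (htop : p ⊤ = 1)
    (hgen : Algebra.adjoin R (Set.range p) = ⊤) {Ω : Set Δ} (hΩ : IsLowerSet Ω)
    (hΩt : ⊤ ∉ Ω) (a : A) :
    a ∈ Ideal.span (p '' Ω) ↔ a ∈ span R (stdMon p '' meets Ω) := by
  constructor
  · intro h
    induction h using span_induction with
    | mem x hx =>
      obtain ⟨c, hc, rfl⟩ := hx
      simpa using prod_mem_span_meets (R := R) hp htop hΩ hΩt {c} ⟨c, by simp, hc⟩
    | zero => exact zero_mem _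
    | add x y _ _ hx hy => exact add_mem hx hy
    | smul a x _ hx =>
      have ha := span_stdMon_eq_top hp htop hgen (mem_top : a ∈ (⊤ : Submodule R A))
      rw [smul_eq_mul]
      have key := mul_mem_mul ha hx
      rw [span_mul_span] at key
      refine span_le.mpr ?_ key
      rintro _ ⟨_, ⟨s, rfl⟩, _, ⟨t, ⟨e, he, heΩ⟩, rfl⟩, rfl⟩
      have := prod_mem_span_meets (R := R) hp htop hΩ hΩt (s.1 + t.1) ⟨e, by simp [he], heΩ⟩
      rwa [Multiset.map_add, Multiset.prod_add] at this
  · intro h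
    refine (span_le (p := (Ideal.span (p '' Ω)).restrictScalars R)).mpr ?_ h
    rintro _ ⟨s, ⟨e, he, heΩ⟩, rfl⟩
    exact Ideal.mem_of_dvd _ (Multiset.dvd_prod (Multiset.mem_map_of_mem p he))
      (Ideal.subset_span ⟨e, heΩ, rfl⟩)

lemma inf_le_of_straightens (hp : Straightens p) (htop : p ⊤ = 1)
    (hgen : Algebra.adjoin R (Set.range p) = ⊤) (hli : LinearIndependent R (stdMon p))
    {Ω₁ Ω₂ : Set Δ} (h₁ : IsLowerSet Ω₁) (h₂ : IsLowerSet Ω₂) (h₁t : ⊤ ∉ Ω₁) (h₂t : ⊤ ∉ Ω₂) :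
    Ideal.span (p '' Ω₁) ⊓ Ideal.span (p '' Ω₂) ≤ Ideal.span (p '' (Ω₁ ∩ Ω₂)) := by
  intro a ha
  have hsp := span_stdMon_eq_top hp htop hgen
  let b := Module.Basis.mk hli hsp
  have hb : ⇑b = stdMon p := Module.Basis.coe_mk hli hsp
  have ha1 := (mem_ideal_span_iff hp htop hgen h₁ h₁t a).mp ha.1
  have ha2 := (mem_ideal_span_iff hp htop hgen h₂ h₂t a).mp ha.2
  rw [mem_ideal_span_iff hp htop hgen (h₁.inter h₂) fun h => h₁t h.1]
  rw [← hb, Module.Basis.mem_span_image] at ha1 ha2 ⊢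
  refine (Set.subset_inter ha1 ha2).trans ?_
  rintro s ⟨⟨e, he, heΩ⟩, ⟨f, hf, hfΩ⟩⟩
  rcases s.2.1.total he hf with h | h
  · exact ⟨e, he, heΩ, h₂ h hfΩ⟩
  · exact ⟨f, hf, h₁ h heΩ, hfΩ⟩

lemma mem_of_mul_mem_of_straightens (hp : Straightens p) (htop : p ⊤ = 1)
    (hgen : Algebra.adjoin R (Set.range p) = ⊤) (hli : LinearIndependent R (stdMon p))
    {c : Δ} (hc : c ≠ ⊤) (a : A) (ha : p c * a ∈ Ideal.span (p '' {x | ¬ c ≤ x})) :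
    a ∈ Ideal.span (p '' {x | ¬ c ≤ x}) := by
  have hsp := span_stdMon_eq_top hp htop hgen
  let b := Module.Basis.mk hli hsp
  have hb : ⇑b = stdMon p := Module.Basis.coe_mk hli hsp
  have hΩ : IsLowerSet {x | ¬ c ≤ x} := fun x y hyx hx hy => hx (hy.trans hyx)
  have hΩt : ⊤ ∉ {x | ¬ c ≤ x} := by simp
  have hiff := mem_ideal_span_iff hp htop hgen hΩ hΩt
  rw [hiff, ← hb, Module.Basis.mem_span_image] at ha ⊢
  intro s hs
  by_contra hsm
  have hcs : ∀ s : StdIdx Δ, s ∉ meets {x | ¬ c ≤ x} → ∀ x ∈ s.1, c ≤ x := by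
    intro s hs x hx
    by_contra h
    exact hs ⟨x, hx, h⟩
  let cs : ∀ s : StdIdx Δ, s ∉ meets {x | ¬ c ≤ x} → StdIdx Δ := fun s hs =>
    ⟨c ::ₘ s.1, s.2.1.cons (hcs s hs), by
      rw [Multiset.mem_cons, not_or]; exact ⟨hc.symm, s.2.2⟩⟩
  have hcsm : ∀ s hs, cs s hs ∉ meets {x | ¬ c ≤ x} := by
    rintro s hs ⟨x, hx, hxc⟩
    rcases Multiset.mem_cons.mp hx with rfl | hx
    · exact hxc le_rfl
    · exact hxc (hcs s hs x hx)
  have key : (b.coord (cs s hsm)) ∘ₗ (LinearMap.mulLeft R (p c)) = b.coord s := by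
    refine b.ext fun s' => ?_
    simp only [LinearMap.comp_apply, LinearMap.mulLeft_apply, Module.Basis.coord_apply,
      Module.Basis.repr_self]
    by_cases hs' : s' ∈ meets {x | ¬ c ≤ x}
    · have h1 : p c * b s' ∈ span R (stdMon p '' meets {x | ¬ c ≤ x}) := by
        rw [← hiff]
        refine Ideal.mul_mem_left _ _ ((hiff _).mpr (subset_span ⟨s', hs', ?_⟩))
        rw [hb]
      rw [← hb, Module.Basis.mem_span_image] at h1
      rw [Finsupp.single_eq_of_ne (by rintro rfl; exact hsm hs')]
      by_contra h2
      exact hcsm s hsm (h1 (Finsupp.mem_support_iff.mpr h2))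
    · have h1 : p c * b s' = b (cs s' hs') := by
        simp only [hb, stdMon, cs, Multiset.map_cons, Multiset.prod_cons]
      rw [h1, Module.Basis.repr_self]
      rcases eq_or_ne s s' with rfl | hne
      · simp
      · rw [Finsupp.single_eq_of_ne hne, Finsupp.single_eq_of_ne]
        intro h
        apply hne
        have := congrArg Subtype.val h
        exact Subtype.ext ((Multiset.cons_inj_right c).mp this)
  have h1 := LinearMap.congr_fun key a
  simp only [LinearMap.comp_apply, LinearMap.mulLeft_apply, Module.Basis.coord_apply] at h1
  have h2 : b.repr (p c * a) (cs s hsm) ≠ 0 := by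
    rw [h1]
    exact Finsupp.mem_support_iff.mp hs
  exact hcsm s hsm (ha (Finsupp.mem_support_iff.mpr h2))

end Straightening

section Pluecker

open Equiv

variable {S : Type*} [CommRing S] {m N : ℕ}

/-- The maximal minor of `W` on the columns listed by `h`. -/
def bracket (W : Matrix (Fin m) (Fin N) S) (h : Fin m → Fin N) : S := (W.submatrix id h).det

lemma bracket_comp_perm (W : Matrix (Fin m) (Fin N) S) (h : Fin m → Fin N) (τ : Perm (Fin m)) :
    bracket W (h ∘ τ) = Perm.sign τ * bracket W h :=
  Matrix.det_permute' τ (W.submatrix id h)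

lemma bracket_eq_zero_of_not_injective (W : Matrix (Fin m) (Fin N) S) {h : Fin m → Fin N}
    (hh : ¬ Function.Injective h) : bracket W h = 0 := by
  simp only [Function.Injective, not_forall] at hh
  obtain ⟨i, j, hij, hne⟩ := hh
  refine Matrix.det_zero_of_column_eq hne fun k => ?_
  simp [hij]

lemma bracket_sort (W : Matrix (Fin m) (Fin N) S) {h : Fin m → Fin N}
    (hh : Function.Injective h) :
    ∃ δ : Fin m → Fin N, StrictMono δ ∧ Set.range δ = Set.range h ∧
      (bracket W h = bracket W δ ∨ bracket W h = -bracket W δ) := by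
  refine ⟨h ∘ Tuple.sort h,
    (Tuple.monotone_sort h).strictMono_of_injective (hh.comp (Tuple.sort h).injective),
    (Tuple.sort h).surjective.range_comp h, ?_⟩
  rw [bracket_comp_perm]
  rcases Int.units_eq_one_or (Perm.sign (Tuple.sort h)) with e | e <;> simp [e]

/-- Sorting does not raise a list of columns whose entries off the `i`-th initial segment are
either entries of `a` at distinct places or below `a i`. -/
lemma le_of_range_eq {a h δ : Fin m → Fin N} (ha : StrictMono a) (hδ : StrictMono δ)
    (hh : Function.Injective h) (hr : Set.range δ = Set.range h) {i : Fin m}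
    (h1 : ∀ j < i, h j = a j)
    (h2 : ∀ j, i ≤ j → h j < a i ∨ ∃ l, i ≤ l ∧ h j = a l) : δ ≤ a := by
  classical
  intro k
  by_contra! hk
  have hcard1 : (Finset.univ.filter fun j => h j ≤ a k).card ≤ k := by
    have : ((Finset.univ.filter fun j => h j ≤ a k).image h) ⊆ (Finset.Iio k).image δ := by
      intro x hx
      simp only [Finset.mem_image, Finset.mem_filter, Finset.mem_univ, true_and,
        Finset.mem_Iio] at hx ⊢
      obtain ⟨j, hj, rfl⟩ := hx
      obtain ⟨l, hl⟩ : h j ∈ Set.range δ := hr ▸ ⟨j, rfl⟩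
      refine ⟨l, ?_, hl⟩
      rw [← hδ.lt_iff_lt, hl]
      exact hj.trans_lt hk
    calc _ = _ := (Finset.card_image_of_injective _ hh).symm
      _ ≤ _ := Finset.card_le_card this
      _ ≤ _ := Finset.card_image_le
      _ = k := by simp
  have hcard2 : (Finset.univ.filter fun j => ¬ h j ≤ a k).card ≤ m - 1 - k := by
    have : ((Finset.univ.filter fun j => ¬ h j ≤ a k).image h) ⊆ (Finset.Ioi k).image a := by
      intro x hx
      simp only [Finset.mem_image, Finset.mem_filter, Finset.mem_univ, true_and,
        Finset.mem_Ioi, not_le] at hx ⊢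
      obtain ⟨j, hj, rfl⟩ := hx
      rcases lt_or_ge j i with hji | hij
      · rw [h1 j hji] at hj ⊢
        exact ⟨j, ha.lt_iff_lt.mp hj, rfl⟩
      · rcases h2 j hij with hlt | ⟨l, hl, e⟩
        · obtain ⟨x, hx⟩ : h j ∈ Set.range δ := hr ▸ ⟨j, rfl⟩
          have hki : k < i := ha.lt_iff_lt.mp (hj.trans hlt)
          exfalso
          have : (Finset.Iic k).image a ⊆ (Finset.univ.filter fun j => h j ≤ a k).image h := by
            intro y hy
            obtain ⟨z, hz, rfl⟩ := Finset.mem_image.mp hy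
            rw [Finset.mem_Iic] at hz
            refine Finset.mem_image.mpr ⟨z, ?_, h1 z (hz.trans_lt hki)⟩
            simp [h1 z (hz.trans_lt hki), ha.le_iff_le, hz]
          have := Finset.card_le_card this
          rw [Finset.card_image_of_injective _ ha.injective,
            Finset.card_image_of_injective _ hh] at this
          simp at this
          omega
        · rw [e] at hj ⊢
          exact ⟨l, ha.lt_iff_lt.mp hj, rfl⟩
    calc _ = _ := (Finset.card_image_of_injective _ hh).symm
      _ ≤ _ := Finset.card_le_card this
      _ ≤ _ := Finset.card_image_le
      _ = m - 1 - k := by simp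
  have := Finset.card_filter_add_card_filter_not (s := (Finset.univ : Finset (Fin m)))
    (fun j => h j ≤ a k)
  simp only [Finset.card_univ, Fintype.card_fin] at this
  have := k.2
  omega

/-- Freezing some of the arguments of an alternating map. -/
def restrictAlt {M P ι : Type*} [AddCommGroup M] [Module S M] [AddCommGroup P] [Module S P]
    (F : M [⋀^ι]→ₗ[S] P) (p : ι → Prop) [DecidablePred p] (z : ι → M) :
    M [⋀^{j // p j}]→ₗ[S] P :=
  { F.toMultilinearMap.domDomRestrict p (fun j => z j) with
    map_eq_zero_of_eq' := fun v i j hv hij => by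
      change F _ = 0
      refine F.map_eq_zero_of_eq _ (i := i) (j := j) ?_ (Subtype.coe_ne_coe.mpr hij)
      simp [i.2, j.2, hv] }

lemma restrictAlt_apply {M P ι : Type*} [AddCommGroup M] [Module S M] [AddCommGroup P]
    [Module S P] (F : M [⋀^ι]→ₗ[S] P) (p : ι → Prop) [DecidablePred p] (z : ι → M)
    (v : {j // p j} → M) :
    restrictAlt F p z v = F fun j => if h : p j then v ⟨j, h⟩ else z j := rfl

lemma detRowAlternating_col (W : Matrix (Fin m) (Fin N) S) (h : Fin m → Fin N) :
    Matrix.detRowAlternating (fun j => W.col (h j)) = bracket W h :=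
  Matrix.det_transpose (W.submatrix id h)

/-- Plücker relation: if `b i < a i`, the product of the brackets of `a` and `b` is a combination
of products of brackets whose first factor is smaller than `a`. -/
theorem bracket_mul_mem (W : Matrix (Fin m) (Fin N) S) {a b : Fin m → Fin N} (ha : StrictMono a)
    (hb : StrictMono b) {i : Fin m} (hi : b i < a i) :
    bracket W a * bracket W b ∈ AddSubgroup.closure {x | ∃ a' c : Fin m → Fin N,
      StrictMono a' ∧ StrictMono c ∧ a' < a ∧ x = bracket W a' * bracket W c} := by
  classical
  let F : (Fin m → S) [⋀^Fin m]→ₗ[S] S := Matrix.detRowAlternating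
  let f := restrictAlt F (fun j => i ≤ j) (fun j => W.col (a j))
  let g := restrictAlt F (fun j => j ≤ i) (fun j => W.col (b j))
  let col : {j // i ≤ j} ⊕ {j // j ≤ i} → Fin N := Sum.elim (fun j => a j) (fun j => b j)
  let v : {j // i ≤ j} ⊕ {j // j ≤ i} → (Fin m → S) := fun x => W.col (col x)
  have hzero : f.domCoprod g = 0 := by
    refine (Pi.basisFun S (Fin m)).ext_alternating fun u hu => ?_
    exfalso
    have h1 := Fintype.card_le_of_injective u hu
    have e1 : Fintype.card {j : Fin m // i ≤ j} = m - i := by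
      rw [Fintype.card_subtype, ← Fin.card_Ici]
      congr 1
      ext; simp
    have e2 : Fintype.card {j : Fin m // j ≤ i} = i + 1 := by
      rw [Fintype.card_subtype, ← Fin.card_Iic]
      congr 1
      ext; simp
    rw [Fintype.card_sum, e1, e2, Fintype.card_fin] at h1
    omega
  let ha' : Perm ({j // i ≤ j} ⊕ {j // j ≤ i}) → Fin m → Fin N := fun σ j =>
    if h : i ≤ j then col (σ (Sum.inl ⟨j, h⟩)) else a j
  let hb' : Perm ({j // i ≤ j} ⊕ {j // j ≤ i}) → Fin m → Fin N := fun σ j =>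
    if h : j ≤ i then col (σ (Sum.inr ⟨j, h⟩)) else b j
  have hsummand : ∀ σ, TensorProduct.lid S S (AlternatingMap.domCoprod.summand f g
      (Quotient.mk'' σ) v) = (Perm.sign σ : ℤ) • (bracket W (ha' σ) * bracket W (hb' σ)) := by
    intro σ
    have e1 : f (fun j => v (σ (Sum.inl j))) = bracket W (ha' σ) := by
      rw [← detRowAlternating_col, restrictAlt_apply]
      congr 1
      ext j : 1
      simp only [ha', v]
      split_ifs <;> rfl
    have e2 : g (fun j => v (σ (Sum.inr j))) = bracket W (hb' σ) := by
      rw [← detRowAlternating_col, restrictAlt_apply]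
      congr 1
      ext j : 1
      simp only [hb', v]
      split_ifs <;> rfl
    rw [AlternatingMap.domCoprod.summand_mk'']
    change TensorProduct.lid S S ((Perm.sign σ : ℤ) • (f (fun j => v (σ (Sum.inl j))) ⊗ₜ[S]
      g (fun j => v (σ (Sum.inr j))))) = _
    rw [map_zsmul, TensorProduct.lid_tmul, e1, e2, smul_eq_mul]
  have hsum := congrArg (TensorProduct.lid S S) (DFunLike.congr_fun hzero v)
  rw [AlternatingMap.zero_apply, map_zero, AlternatingMap.domCoprod_apply, sum_apply,
    map_sum] at hsum
  replace hsum := (Finset.add_sum_erase _ _ (Finset.mem_univ (Quotient.mk'' 1 :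
      Perm.ModSumCongr {j // i ≤ j} {j // j ≤ i}))).trans hsum
  have hone : bracket W (ha' 1) * bracket W (hb' 1) = bracket W a * bracket W b := by
    congr 2
    · ext j : 1
      simp [ha', col]
    · ext j : 1
      simp [hb', col]
  rw [hsummand, Perm.sign_one, hone, Units.val_one, one_smul] at hsum
  rw [eq_neg_of_add_eq_zero_left hsum]
  refine neg_mem (sum_mem fun q hq => ?_)
  induction q using Quotient.inductionOn' with | h σ => ?_
  rw [hsummand]
  refine zsmul_mem ?_ _
  have hσ : ∃ j l, σ (Sum.inl j) = Sum.inr l := by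
    by_contra! hcon
    refine (Finset.ne_of_mem_erase hq) ?_
    refine Quotient.sound' ?_
    rw [QuotientGroup.leftRel_apply, mul_one, inv_mem_iff]
    refine Perm.mem_sumCongrHom_range_of_perm_mapsTo_inl ?_
    rintro _ ⟨j, rfl⟩
    rcases hx : σ (Sum.inl j) with l | l
    · exact ⟨l, rfl⟩
    · exact absurd hx (hcon j l)
  by_cases hainj : Function.Injective (ha' σ)
  swap
  · rw [bracket_eq_zero_of_not_injective W hainj, zero_mul]
    exact zero_mem _
  by_cases hbinj : Function.Injective (hb' σ)
  swap
  · rw [bracket_eq_zero_of_not_injective W hbinj, mul_zero]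
    exact zero_mem _
  obtain ⟨δ, hδ, hδr, hδb⟩ := bracket_sort W hainj
  obtain ⟨c, hc, -, hcb⟩ := bracket_sort W hbinj
  have h1 : ∀ j < i, ha' σ j = a j := fun j hj => by simp [ha', hj.not_ge]
  have hle : δ ≤ a := by
    refine le_of_range_eq ha hδ hainj hδr h1 fun j hj => ?_
    simp only [ha', hj, dite_true]
    rcases σ (Sum.inl ⟨j, hj⟩) with l | l
    · exact Or.inr ⟨l, l.2, rfl⟩
    · exact Or.inl ((hb.monotone l.2).trans_lt hi)
  have hne : δ ≠ a := by
    rintro rfl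
    obtain ⟨j, l, hjl⟩ := hσ
    have hj : ha' σ j = b l := by simp [ha', j.2, hjl, col]
    obtain ⟨k, hk⟩ : b l ∈ Set.range δ := by rw [hδr]; exact ⟨j, hj⟩
    have hki : k < i := by
      rw [← hδ.lt_iff_lt, hk]
      exact (hb.monotone l.2).trans_lt hi
    have := hainj ((h1 k hki).trans (hk.trans hj.symm))
    exact absurd j.2 (by rw [← this]; exact hki.not_ge)
  have hmem : bracket W δ * bracket W c ∈ AddSubgroup.closure {x | ∃ a' c : Fin m → Fin N,
      StrictMono a' ∧ StrictMono c ∧ a' < a ∧ x = bracket W a' * bracket W c} :=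
    AddSubgroup.subset_closure ⟨δ, c, hδ, hc, lt_of_le_of_ne hle hne, rfl⟩
  rcases hδb with e | e <;> rcases hcb with e' | e' <;>
    simpa only [e, e', neg_mul, mul_neg, neg_neg, neg_mem_iff] using hmem

end Pluecker

section Columns

variable {S : Type*} [CommRing S] {m n : ℕ}

variable (m n) in
/-- The lattice of increasing lists of `m` columns of an `m × (n + m)` matrix. -/
def colSublattice : Sublattice (Fin m → Fin (n + m)) where
  carrier := {f | StrictMono f}
  supClosed' _ hf _ hg _ _ hij := max_lt_max (hf hij) (hg hij)
  infClosed' _ hf _ hg _ _ hij := min_lt_min (hf hij) (hg hij)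

variable (m n) in
/-- Increasing lists of `m` columns of an `m × (n + m)` matrix, ordered pointwise. -/
abbrev Cols : Type := ↥(colSublattice m n)

lemma strictMono_add_le {N : ℕ} {f : Fin m → Fin N} (hf : StrictMono f) (i : Fin m) (k : ℕ)
    (hk : i + k < m) : (f i : ℕ) + k ≤ f ⟨i + k, hk⟩ := by
  induction k with
  | zero => rfl
  | succ k ih =>
    have h1 := ih (by omega)
    have h2 : f ⟨i + k, by omega⟩ < f ⟨i + (k + 1), hk⟩ := hf (by simp [Fin.lt_def])
    rw [Fin.lt_def] at h2
    omega

lemma le_strictMono {N : ℕ} {f : Fin m → Fin N} (hf : StrictMono f) (i : Fin m) :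
    (i : ℕ) ≤ f i := by
  have := strictMono_add_le hf ⟨0, i.pos⟩ i (by simp)
  simp only [zero_add, Fin.eta] at this
  omega

lemma strictMono_le {f : Fin m → Fin (n + m)} (hf : StrictMono f) (i : Fin m) :
    (f i : ℕ) ≤ n + i := by
  have := strictMono_add_le hf i (m - 1 - i) (by omega)
  have h2 := (f ⟨i + (m - 1 - i), by omega⟩).2
  omega

instance : OrderTop (Cols m n) where
  top := ⟨Fin.natAdd n, Fin.strictMono_natAdd n⟩
  le_top a i := by
    rw [Fin.le_def]
    exact strictMono_le a.2 i

lemma coe_top_cols : ((⊤ : Cols m n) : Fin m → Fin (n + m)) = Fin.natAdd n := rfl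

/-- The corank of an increasing list of columns. -/
def corank (a : Cols m n) : ℕ := ∑ i : Fin m, (n + i - a.1 i)

lemma corank_top : corank (⊤ : Cols m n) = 0 := by
  simp [corank, coe_top_cols]

lemma corank_covBy {a b : Cols m n} (hab : a ⋖ b) : corank a = corank b + 1 := by
  classical
  obtain ⟨i0, hi0⟩ : ∃ i, a.1 i < b.1 i := by
    by_contra! h
    exact hab.lt.not_ge h
  obtain ⟨i, hi⟩ := (Finset.univ.filter fun i => a.1 i < b.1 i).exists_maximal ⟨i0, by simpa⟩
  have hlt : a.1 i < b.1 i := by simpa using hi.1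
  have heq : ∀ k, i < k → a.1 k = b.1 k := by
    intro k hk
    refine le_antisymm (hab.le k) ?_
    by_contra! h
    exact absurd (hi.2 (by simpa using h) hk.le) hk.not_ge
  let x : Fin (n + m) := ⟨a.1 i + 1, by have := (b.1 i).2; rw [Fin.lt_def] at hlt; omega⟩
  have hx : StrictMono (Function.update a.1 i x) := by
    intro j k hjk
    rcases eq_or_ne j i with rfl | hj
    · have h1 := b.2 hjk
      rw [← heq k hjk] at h1
      simp only [Function.update_self, Function.update_of_ne hjk.ne', Fin.lt_def, x] at h1 hlt ⊢
      omega
    · rw [Function.update_of_ne hj]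
      rcases eq_or_ne k i with rfl | hk
      · have h1 := a.2 hjk
        simp only [Function.update_self, Fin.lt_def, x] at h1 ⊢
        omega
      · rw [Function.update_of_ne hk]
        exact a.2 hjk
  have hax : a < (⟨_, hx⟩ : Cols m n) := by
    refine lt_of_le_not_ge (fun j => ?_) fun h => ?_
    · rcases eq_or_ne j i with rfl | hj
      · simp [Fin.le_def, x]
      · simp [Function.update_of_ne hj]
    · have := h i
      simp [Fin.le_def, x] at this
  have hxb : (⟨_, hx⟩ : Cols m n) ≤ b := by
    intro j
    rcases eq_or_ne j i with rfl | hj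
    · simp only [Function.update_self, Fin.le_def, x, Fin.lt_def] at hlt ⊢
      omega
    · simpa [Function.update_of_ne hj] using hab.le j
  have hb : (⟨_, hx⟩ : Cols m n) = b := (hab.eq_or_eq hax.le hxb).resolve_left hax.ne'
  rw [← hb]
  have key : ∀ j : Fin m, n + (j : ℕ) - a.1 j =
      (n + j - Function.update a.1 i x j) + if j = i then 1 else 0 := by
    intro j
    rcases eq_or_ne j i with rfl | hj
    · have h1 := strictMono_le hx j
      simp only [Function.update_self, if_true, x] at h1 ⊢
      omega
    · simp [hj]
  simp only [corank]
  rw [Finset.sum_congr rfl fun j _ => key j, Finset.sum_add_distrib]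
  simp

/-- The matrix `[X | 1]`. -/
def extMat (X : Matrix (Fin m) (Fin n) S) : Matrix (Fin m) (Fin (n + m)) S :=
  Matrix.of fun i => Fin.append (X i) ((1 : Matrix (Fin m) (Fin m) S) i)

lemma extMat_castAdd (X : Matrix (Fin m) (Fin n) S) (i : Fin m) (j : Fin n) :
    extMat X i (Fin.castAdd m j) = X i j := by
  simp [extMat]

lemma extMat_natAdd (X : Matrix (Fin m) (Fin n) S) (i : Fin m) (j : Fin m) :
    extMat X i (Fin.natAdd n j) = (1 : Matrix (Fin m) (Fin m) S) i j := by
  simp [extMat]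

/-- The maximal minor of `W` on an increasing list of columns. -/
def minor (W : Matrix (Fin m) (Fin (n + m)) S) (a : Cols m n) : S := bracket W a.1

lemma straightens_minor (W : Matrix (Fin m) (Fin (n + m)) S) : Straightens (minor W) := by
  intro a b hab
  obtain ⟨i, hi⟩ : ∃ i, b.1 i < a.1 i := by
    by_contra! h
    exact hab h
  refine AddSubgroup.closure_mono ?_ (bracket_mul_mem W a.2 b.2 hi)
  rintro _ ⟨a', c, ha', hc, hlt, rfl⟩
  exact ⟨⟨a', ha'⟩, ⟨c, hc⟩, hlt, rfl⟩

lemma minor_extMat_top (X : Matrix (Fin m) (Fin n) S) : minor (extMat X) ⊤ = 1 := by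
  rw [minor, bracket, coe_top_cols]
  have : (extMat X).submatrix id (Fin.natAdd n) = 1 := by
    ext i j
    simp [extMat_natAdd]
  rw [this, Matrix.det_one]

lemma bracket_update_top (X : Matrix (Fin m) (Fin n) S) (i : Fin m) (j : Fin n) :
    bracket (extMat X) (Function.update (Fin.natAdd n) i (Fin.castAdd m j)) = X i j := by
  have : (extMat X).submatrix id (Function.update (Fin.natAdd n) i (Fin.castAdd m j)) =
      (1 : Matrix (Fin m) (Fin m) S).updateCol i (X.col j) := by
    ext k l
    rcases eq_or_ne l i with rfl | hl
    · simp [extMat_castAdd]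
    · simp [Function.update_of_ne hl, extMat_natAdd, Matrix.updateCol_ne hl]
  rw [bracket, this, ← Matrix.cramer_apply, Matrix.cramer_one]
  rfl

lemma bracket_eq_minor (W : Matrix (Fin m) (Fin (n + m)) S) {h : Fin m → Fin (n + m)}
    (hh : Function.Injective h) :
    ∃ δ : Cols m n, Set.range δ.1 = Set.range h ∧
      (bracket W h = minor W δ ∨ bracket W h = -minor W δ) := by
  obtain ⟨δ, h1, h2, h3⟩ := bracket_sort W hh
  exact ⟨⟨δ, h1⟩, h2, h3⟩

variable (m n) in
/-- The generic `m × n` matrix over `R`. -/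
noncomputable abbrev genericMatrix (R : Type*) [CommRing R] :
    Matrix (Fin m) (Fin n) (MvPolynomial (Fin m × Fin n) R) :=
  Matrix.of fun i j => MvPolynomial.X (i, j)

lemma adjoin_minor_eq_top (R : Type*) [CommRing R] :
    Algebra.adjoin R (Set.range (minor (extMat (genericMatrix m n R)))) = ⊤ := by
  classical
  rw [eq_top_iff, ← MvPolynomial.adjoin_range_X, Algebra.adjoin_le_iff]
  rintro _ ⟨⟨i, j⟩, rfl⟩
  have h := bracket_update_top (genericMatrix m n R) i j
  rw [genericMatrix, Matrix.of_apply] at h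
  rw [← h]
  by_cases hinj : Function.Injective (Function.update (Fin.natAdd n) i (Fin.castAdd m j))
  · obtain ⟨δ, -, e | e⟩ := bracket_eq_minor (extMat (genericMatrix m n R)) hinj
    · rw [e]
      exact Algebra.subset_adjoin ⟨δ, rfl⟩
    · rw [e]
      exact neg_mem (Algebra.subset_adjoin ⟨δ, rfl⟩)
  · rw [bracket_eq_zero_of_not_injective _ hinj]
    exact zero_mem _

end Columns

section Independence

open MvPolynomial

lemma monic_multiset_prod {σ R ι : Type*} [CommRing R] [Nontrivial R] (mo : MonomialOrder σ)
    (v : ι → MvPolynomial σ R) (e : ι → σ →₀ ℕ) (hv : ∀ i, mo.Monic (v i) ∧ mo.degree (v i) = e i)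
    (s : Multiset ι) :
    mo.Monic (s.map v).prod ∧ mo.degree (s.map v).prod = (s.map e).sum := by
  induction s using Multiset.induction with
  | empty => simp
  | cons i s ih =>
    rw [Multiset.map_cons, Multiset.prod_cons, Multiset.map_cons, Multiset.sum_cons]
    refine ⟨(hv i).1.mul ih.1, ?_⟩
    rw [mo.degree_mul_of_mul_leadingCoeff_ne_zero, (hv i).2, ih.2]
    rw [(hv i).1.leadingCoeff_eq_one, ih.1.leadingCoeff_eq_one]
    simp

lemma linearIndependent_of_degree_injective {σ R ι : Type*} [CommRing R]
    (mo : MonomialOrder σ) (v : ι → MvPolynomial σ R) (hv : ∀ i, mo.Monic (v i))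
    (hinj : Function.Injective fun i => mo.degree (v i)) : LinearIndependent R v := by
  classical
  rw [linearIndependent_iff]
  intro l hl
  by_contra hne
  obtain ⟨i, hi, hmax⟩ := l.support.exists_max_image (fun i => mo.toSyn (mo.degree (v i)))
    (Finsupp.support_nonempty_iff.mpr hne)
  have h := congrArg (coeff (mo.degree (v i))) hl
  rw [Finsupp.linearCombination_apply, Finsupp.sum, coeff_sum, Finset.sum_eq_single_of_mem i hi,
    coeff_smul, (hv i).coeff_degree, smul_eq_mul, mul_one, coeff_zero] at h
  · exact (Finsupp.mem_support_iff.mp hi) h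
  · intro j hj hji
    rw [coeff_smul, mo.coeff_eq_zero_of_lt, smul_zero]
    refine lt_of_le_of_ne (hmax j hj) fun e => hji (hinj (mo.toSyn.injective e))

variable {m n : ℕ}

lemma ext_of_row_eq (hm : 0 < m) {s t : Multiset (Cols m n)} (hs : IsStd s) (ht : IsStd t)
    (h : ∀ i, s.map (fun δ => δ.1 i) = t.map (fun δ => δ.1 i)) : s = t := by
  induction hk : s.card generalizing s t with
  | zero =>
    have h1 := congrArg Multiset.card (h ⟨0, hm⟩)
    rw [Multiset.card_map, Multiset.card_map, hk] at h1
    rw [Multiset.card_eq_zero.mp hk, Multiset.card_eq_zero.mp h1.symm]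
  | succ k ih =>
    have h1 := congrArg Multiset.card (h ⟨0, hm⟩)
    rw [Multiset.card_map, Multiset.card_map, hk] at h1
    obtain ⟨b, hb, hbmin⟩ := hs.exists_min (by rintro rfl; simp at hk)
    obtain ⟨c, hc, hcmin⟩ := ht.exists_min (by rintro rfl; simp at h1)
    have hbc : b = c := by
      refine le_antisymm (fun i => ?_) (fun i => ?_)
      · have : c.1 i ∈ s.map (fun δ => δ.1 i) := h i ▸ Multiset.mem_map_of_mem _ hc
        obtain ⟨δ, hδ, e⟩ := Multiset.mem_map.mp this
        exact (hbmin δ hδ i).trans e.le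
      · have : b.1 i ∈ t.map (fun δ => δ.1 i) := h i ▸ Multiset.mem_map_of_mem _ hb
        obtain ⟨δ, hδ, e⟩ := Multiset.mem_map.mp this
        exact (hcmin δ hδ i).trans e.le
    subst hbc
    obtain ⟨s, rfl⟩ := Multiset.exists_cons_of_mem hb
    obtain ⟨t, rfl⟩ := Multiset.exists_cons_of_mem hc
    rw [ih (hs.mono fun x hx => Multiset.mem_cons_of_mem hx)
      (ht.mono fun x hx => Multiset.mem_cons_of_mem hx) (fun i => ?_) (by simpa using hk)]
    simpa using h i

/-- The exponent of the `(i, j)` entry of the banded matrix. -/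
noncomputable def bandExp (i : Fin m) (j : Fin (n + m)) : (Fin m ×ₗ Fin n) →₀ ℕ :=
  Finsupp.equivFunOnFinite.symm fun x =>
    if i = (ofLex x).1 ∧ (j : ℕ) = i + (ofLex x).2 then 1 else 0

lemma bandExp_apply (i : Fin m) (j : Fin (n + m)) (x : Fin m ×ₗ Fin n) :
    bandExp i j x = if i = (ofLex x).1 ∧ (j : ℕ) = i + (ofLex x).2 then 1 else 0 := rfl

/-- The exponent of the product of the entries `(i, h i)` of the banded matrix. -/
noncomputable def diagExp (h : Fin m → Fin (n + m)) : (Fin m ×ₗ Fin n) →₀ ℕ :=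
  ∑ i, bandExp i (h i)

lemma diagExp_apply (h : Fin m → Fin (n + m)) (x : Fin m ×ₗ Fin n) :
    diagExp h x = if (h (ofLex x).1 : ℕ) = (ofLex x).1 + (ofLex x).2 then 1 else 0 := by
  classical
  rw [diagExp, Finsupp.finsetSum_apply, Finset.sum_eq_single (ofLex x).1]
  · simp [bandExp_apply]
  · intro i _ hi
    simp [bandExp_apply, hi]
  · simp

lemma stdIdx_ext_of_exp (hm : 0 < m) {s t : StdIdx (Cols m n)}
    (h : (s.1.map fun δ => diagExp δ.1).sum = (t.1.map fun δ => diagExp δ.1).sum) : s = t := by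
  classical
  have happ : ∀ (u : Multiset (Cols m n)) (x : Fin m ×ₗ Fin n),
      (u.map fun δ => diagExp δ.1).sum x =
      (u.map fun δ => δ.1 (ofLex x).1).count
        ⟨(ofLex x).1 + (ofLex x).2, by omega⟩ := by
    intro u x
    induction u using Multiset.induction with
    | empty => simp
    | cons δ u ih =>
      rw [Multiset.map_cons, Multiset.sum_cons, Finsupp.add_apply, ih, Multiset.map_cons,
        Multiset.count_cons, diagExp_apply, add_comm]
      congr 1
      simp [Fin.ext_iff, eq_comm]
  have hne : ∀ (i : Fin m) (v : Fin (n + m)), (v : ℕ) ≠ n + i →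
      (s.1.map fun δ => δ.1 i).count v = (t.1.map fun δ => δ.1 i).count v := by
    intro i v hv
    by_cases hiv : (i : ℕ) ≤ v ∧ (v : ℕ) < n + i
    · have := DFunLike.congr_fun h (toLex (i, ⟨v - i, by omega⟩))
      rw [happ, happ] at this
      have e : v = ⟨(i : ℕ) + (v - i), by omega⟩ := by
        ext
        simp only
        omega
      rw [e]
      exact this
    · have aux : ∀ u : Multiset (Cols m n), (u.map fun δ => δ.1 i).count v = 0 := by
        intro u
        rw [Multiset.count_eq_zero]
        intro hmem
        obtain ⟨δ, -, rfl⟩ := Multiset.mem_map.mp hmem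
        have h1 := le_strictMono δ.2 i
        have h2 := strictMono_le δ.2 i
        omega
      rw [aux, aux]
  have hrow0 : ∀ u : StdIdx (Cols m n),
      (u.1.map fun δ => δ.1 ⟨0, hm⟩).count (Fin.natAdd n ⟨0, hm⟩) = 0 := by
    intro u
    rw [Multiset.count_eq_zero]
    intro hmem
    obtain ⟨δ, hδ, e⟩ := Multiset.mem_map.mp hmem
    apply u.2.2
    convert hδ
    refine (top_le_iff.mp fun i => ?_).symm
    have h1 := strictMono_add_le δ.2 ⟨0, hm⟩ i (by simp)
    rw [e] at h1
    rw [coe_top_cols, Fin.le_def]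
    simpa using h1
  have hcard : s.1.card = t.1.card := by
    rw [← Multiset.card_map (fun δ : Cols m n => δ.1 ⟨0, hm⟩) s.1,
      ← Multiset.card_map (fun δ : Cols m n => δ.1 ⟨0, hm⟩) t.1]
    congr 1
    ext v
    by_cases hv : (v : ℕ) = n + (0 : ℕ)
    · have : v = Fin.natAdd n ⟨0, hm⟩ := by
        ext
        simpa using hv
      rw [this, hrow0, hrow0]
    · exact hne ⟨0, hm⟩ v hv
  refine Subtype.ext (ext_of_row_eq hm s.2.1 t.2.1 fun i => ?_)
  ext v
  by_cases hv : (v : ℕ) = n + i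
  · have aux : ∀ u : Multiset (Cols m n), (u.map fun δ => δ.1 i).count v +
        ∑ w ∈ Finset.univ.erase v, (u.map fun δ => δ.1 i).count w = u.card := by
      intro u
      rw [Finset.add_sum_erase _ (fun w => (u.map fun δ => δ.1 i).count w) (Finset.mem_univ v),
        Multiset.sum_count_eq_card (fun _ _ => Finset.mem_univ _), Multiset.card_map]
    have h1 := aux s.1
    rw [Finset.sum_congr rfl fun w hw => hne i w fun e =>
      Finset.ne_of_mem_erase hw (Fin.ext (e.trans hv.symm)), hcard, ← aux t.1] at h1
    exact Nat.add_right_cancel h1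
  · exact hne i v hv

variable (R : Type*) [CommRing R]

variable (m n) in
/-- The banded matrix whose `(i, i + k)` entry is a variable for `k < n` and `1` for `k = n`. -/
noncomputable def bandMat : Matrix (Fin m) (Fin (n + m)) (MvPolynomial (Fin m ×ₗ Fin n) R) :=
  Matrix.of fun i j => if (i : ℕ) ≤ j ∧ (j : ℕ) ≤ n + i then monomial (bandExp i j) 1 else 0

lemma bandMat_prod (h : Fin m → Fin (n + m)) : ∏ i, bandMat m n R i (h i) =
    if ∀ i : Fin m, (i : ℕ) ≤ h i ∧ (h i : ℕ) ≤ n + i then monomial (diagExp h) 1 else 0 := by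
  split_ifs with hh
  · rw [diagExp, monomial_sum_one]
    exact Finset.prod_congr rfl fun i _ => by simp [bandMat, hh i]
  · push Not at hh
    obtain ⟨i, hi⟩ := hh
    refine Finset.prod_eq_zero (Finset.mem_univ i) ?_
    rw [bandMat, Matrix.of_apply, if_neg]
    intro h1
    exact absurd h1.2 (hi h1.1).not_ge

lemma diagExp_lt {δ : Fin m → Fin (n + m)} (hδ : StrictMono δ) {τ : Equiv.Perm (Fin m)}
    (hτ : τ ≠ 1) (hb : ∀ i : Fin m, (i : ℕ) ≤ δ (τ i) ∧ (δ (τ i) : ℕ) ≤ n + i) :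
    toLex (diagExp (δ ∘ τ)) < toLex (diagExp δ) := by
  classical
  obtain ⟨i0, hi0⟩ : ∃ i, τ i ≠ i := by
    by_contra! h
    exact hτ (Equiv.ext h)
  obtain ⟨i, hi⟩ := (Finset.univ.filter fun i => τ i ≠ i).exists_minimal ⟨i0, by simpa⟩
  have hne : τ i ≠ i := by simpa using hi.1
  have heq : ∀ k, k < i → τ k = k := by
    intro k hk
    by_contra! h
    exact absurd (hi.2 (by simpa using h) hk.le) hk.not_ge
  have hlt : i < τ i := by
    by_contra! h
    exact hne (τ.injective (heq _ (lt_of_le_of_ne h hne)))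
  have hδlt := hδ hlt
  rw [Fin.lt_def] at hδlt
  have h1 := le_strictMono hδ i
  have h2 := (hb i).2
  rw [Finsupp.Lex.lt_iff]
  refine ⟨toLex (i, ⟨δ i - i, by omega⟩), fun x hx => ?_, ?_⟩
  · rw [ofLex_toLex, ofLex_toLex, diagExp_apply, diagExp_apply]
    rw [Prod.Lex.lt_iff] at hx
    rcases hx with hx | ⟨hx, hx'⟩
    · rw [Function.comp_apply, heq _ hx]
    · rw [Function.comp_apply, hx]
      change (if (δ (τ i) : ℕ) = i + (ofLex x).2 then 1 else 0) =
        if (δ i : ℕ) = i + (ofLex x).2 then 1 else 0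
      simp only [ofLex_toLex, Fin.lt_def] at hx'
      rw [if_neg (by omega), if_neg (by omega)]
  · rw [ofLex_toLex, ofLex_toLex, diagExp_apply, diagExp_apply]
    change (if (δ (τ i) : ℕ) = i + (δ i - i) then 1 else 0) <
      if (δ i : ℕ) = i + (δ i - i) then 1 else 0
    rw [if_neg (by omega), if_pos (by omega)]
    exact one_pos

lemma monic_minor_bandMat [Nontrivial R] (δ : Cols m n) :
    MonomialOrder.lex.Monic (minor (bandMat m n R) δ) ∧
      MonomialOrder.lex.degree (minor (bandMat m n R) δ) = diagExp δ.1 := by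
  classical
  have hdet : minor (bandMat m n R) δ = ∑ τ : Equiv.Perm (Fin m), (Equiv.Perm.sign τ : ℤ) •
      if ∀ i : Fin m, (i : ℕ) ≤ δ.1 (τ i) ∧ (δ.1 (τ i) : ℕ) ≤ n + i then
        monomial (diagExp (δ.1 ∘ τ)) (1 : R) else 0 := by
    rw [minor, bracket, ← Matrix.det_transpose, Matrix.det_apply]
    refine Finset.sum_congr rfl fun τ _ => ?_
    exact congrArg (fun z => (Equiv.Perm.sign τ : ℤ) • z) (bandMat_prod R (δ.1 ∘ τ))
  have hone : coeff (diagExp δ.1) (minor (bandMat m n R) δ) = 1 := by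
    rw [hdet, coeff_sum, Finset.sum_eq_single 1]
    · rw [if_pos fun i => ⟨le_strictMono δ.2 _, strictMono_le δ.2 _⟩]
      simp
    · intro τ _ hτ
      split_ifs with hb
      · have := diagExp_lt δ.2 hτ hb
        rw [coeff_smul, coeff_monomial, if_neg, smul_zero]
        intro e
        rw [e] at this
        exact lt_irrefl _ this
      · simp
    · simp
  have hle : ∀ d ∈ (minor (bandMat m n R) δ).support, toLex d ≤ toLex (diagExp δ.1) := by
    intro d hd
    by_contra hcon
    rw [mem_support_iff] at hd
    apply hd
    rw [hdet, coeff_sum]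
    refine Finset.sum_eq_zero fun τ _ => ?_
    split_ifs with hb
    · rw [coeff_smul, coeff_monomial, if_neg, smul_zero]
      rintro rfl
      apply hcon
      rcases eq_or_ne τ 1 with rfl | hτ
      · exact le_rfl
      · exact (diagExp_lt δ.2 hτ hb).le
    · simp
  have hdeg : MonomialOrder.lex.degree (minor (bandMat m n R) δ) = diagExp δ.1 := by
    refine MonomialOrder.lex.toSyn.injective (le_antisymm ?_ ?_)
    · exact MonomialOrder.degree_le_iff.mpr hle
    · refine MonomialOrder.le_degree ?_
      rw [mem_support_iff, hone]
      exact one_ne_zero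
  refine ⟨?_, hdeg⟩
  rw [MonomialOrder.Monic, MonomialOrder.leadingCoeff, hdeg, hone]

lemma bracket_mul {S : Type*} [CommRing S] {N : ℕ} (B : Matrix (Fin m) (Fin m) S)
    (W : Matrix (Fin m) (Fin N) S) (h : Fin m → Fin N) :
    bracket (B * W) h = B.det * bracket W h := by
  rw [bracket, bracket, ← Matrix.det_mul]
  rfl

lemma map_minor_extMat {S T : Type*} [CommRing S] [CommRing T] (φ : S →+* T)
    (X : Matrix (Fin m) (Fin n) S) (δ : Cols m n) :
    φ (minor (extMat X) δ) = minor (extMat (X.map φ)) δ := by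
  rw [minor, minor, bracket, bracket, RingHom.map_det]
  congr 1
  ext i j
  simp only [RingHom.mapMatrix_apply, Matrix.map_apply, Matrix.submatrix_apply, id]
  refine Fin.addCases (fun k => ?_) (fun k => ?_) (δ.1 j)
  · rw [extMat_castAdd, extMat_castAdd, Matrix.map_apply]
  · rw [extMat_natAdd, extMat_natAdd, Matrix.one_apply, Matrix.one_apply, apply_ite φ, map_one,
      map_zero]

lemma exists_extMat_minor_eq : ∃ X : Matrix (Fin m) (Fin n) (MvPolynomial (Fin m ×ₗ Fin n) R),
    minor (extMat X) = minor (bandMat m n R) := by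
  classical
  set Z := (bandMat m n R).submatrix id (Fin.natAdd n) with hZ
  have hdet : Z.det = 1 := by
    rw [Matrix.det_of_isLowerTriangular]
    · refine Finset.prod_eq_one fun i _ => ?_
      have : bandExp i (Fin.natAdd n i) = 0 := by
        ext x
        rw [bandExp_apply, if_neg, Finsupp.zero_apply]
        rintro ⟨-, h⟩
        simp only [Fin.val_natAdd] at h
        omega
      rw [hZ, Matrix.submatrix_apply, bandMat, Matrix.of_apply, if_pos (by simp), id, this]
      rfl
    · intro i j hij
      rw [OrderDual.toDual_lt_toDual, Fin.lt_def] at hij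
      rw [hZ, Matrix.submatrix_apply, bandMat, Matrix.of_apply, if_neg]
      simp only [id, Fin.val_natAdd]
      omega
  have hunit : IsUnit Z.det := by rw [hdet]; exact isUnit_one
  have hinv : Z⁻¹.det = 1 := by rw [Matrix.det_nonsing_inv, hdet, Ring.inverse_one]
  refine ⟨(Z⁻¹ * bandMat m n R).submatrix id (Fin.castAdd m), ?_⟩
  have hext : extMat ((Z⁻¹ * bandMat m n R).submatrix id (Fin.castAdd m)) =
      Z⁻¹ * bandMat m n R := by
    ext1 i j
    refine Fin.addCases (fun k => ?_) (fun k => ?_) j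
    · rw [extMat_castAdd]
      rfl
    · rw [extMat_natAdd, ← Matrix.nonsing_inv_mul Z hunit]
      rfl
  ext1 δ
  rw [hext, minor, bracket_mul, hinv, one_mul]
  rfl

/-- The standard monomials in the minors of the generic matrix are linearly independent. -/
theorem linearIndependent_stdMon [Nontrivial R] (hm : 0 < m) :
    LinearIndependent R (stdMon (minor (extMat (genericMatrix m n R)))) := by
  obtain ⟨X', hX'⟩ := exists_extMat_minor_eq (m := m) (n := n) R
  let φ : MvPolynomial (Fin m × Fin n) R →ₐ[R] MvPolynomial (Fin m ×ₗ Fin n) R :=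
    aeval fun x => X' x.1 x.2
  refine LinearIndependent.of_comp φ.toLinearMap ?_
  have hφ : φ.toLinearMap ∘ stdMon (minor (extMat (genericMatrix m n R))) =
      stdMon (minor (bandMat m n R)) := by
    ext1 s
    rw [Function.comp_apply, AlgHom.toLinearMap_apply, stdMon, map_multiset_prod,
      Multiset.map_map, stdMon, ← hX']
    congr 2
    ext1 δ
    refine (map_minor_extMat φ.toRingHom _ δ).trans ?_
    congr 2
    ext1 i j
    simp [φ]
  rw [hφ]
  have hmon := fun s : StdIdx (Cols m n) => monic_multiset_prod MonomialOrder.lex _ _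
    (monic_minor_bandMat (m := m) (n := n) R) s.1
  refine linearIndependent_of_degree_injective MonomialOrder.lex _ (fun s => (hmon s).1) ?_
  intro s t hst
  refine stdIdx_ext_of_exp hm ?_
  rw [← (hmon s).2, ← (hmon t).2]
  exact hst

end Independence

section MinorIdeal

variable {S : Type*} [CommRing S] {m n : ℕ}

/-- The ideal generated by the `t × t` minors of a matrix, repeated rows and columns allowed. -/
def minorIdeal (B : Matrix (Fin m) (Fin n) S) (t : ℕ) : Ideal S :=
  Ideal.span (Set.range fun x : (Fin t → Fin m) × (Fin t → Fin n) => (B.submatrix x.1 x.2).det)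

lemma det_mem_minorIdeal (B : Matrix (Fin m) (Fin n) S) {t : ℕ} (f : Fin t → Fin m)
    (g : Fin t → Fin n) : (B.submatrix f g).det ∈ minorIdeal B t :=
  Ideal.subset_span ⟨(f, g), rfl⟩

lemma minorIdeal_le {B : Matrix (Fin m) (Fin n) S} {t : ℕ} {I : Ideal S}
    (h : ∀ (f : Fin t → Fin m) (g : Fin t → Fin n), Function.Injective f →
      Function.Injective g → (B.submatrix f g).det ∈ I) : minorIdeal B t ≤ I := by
  rw [minorIdeal, Ideal.span_le]
  rintro _ ⟨⟨f, g⟩, rfl⟩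
  by_cases hf : Function.Injective f
  · by_cases hg : Function.Injective g
    · exact h f g hf hg
    · simp only [Function.Injective, not_forall] at hg
      obtain ⟨i, j, hij, hne⟩ := hg
      simp only [SetLike.mem_coe]
      rw [Matrix.det_zero_of_column_eq hne fun k => by simp [hij]]
      exact zero_mem _
  · simp only [Function.Injective, not_forall] at hf
    obtain ⟨i, j, hij, hne⟩ := hf
    simp only [SetLike.mem_coe]
    rw [Matrix.det_zero_of_row_eq hne (by ext k; simp [hij])]
    exact zero_mem _

lemma detIdeal_eq_minorIdeal (B : Matrix (Fin m) (Fin n) S) (t : ℕ) :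
    detIdeal B (t : ℤ) = minorIdeal B t := by
  refine le_antisymm (Ideal.span_le.mpr ?_) (minorIdeal_le fun f g hf hg => ?_)
  · rintro _ ⟨f, g, -, -, rfl⟩
    exact det_mem_minorIdeal B f g
  · exact Ideal.subset_span ⟨f, g, hf, hg, rfl⟩

lemma minorIdeal_submatrix_le {k l : ℕ} (B : Matrix (Fin m) (Fin n) S) (e : Fin k → Fin m)
    (e' : Fin l → Fin n) (t : ℕ) : minorIdeal (B.submatrix e e') t ≤ minorIdeal B t :=
  minorIdeal_le fun f g _ _ => det_mem_minorIdeal B (e ∘ f) (e' ∘ g)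

lemma minorIdeal_submatrix_equiv (B : Matrix (Fin m) (Fin n) S) (e : Equiv.Perm (Fin m))
    (e' : Equiv.Perm (Fin n)) (t : ℕ) : minorIdeal (B.submatrix e e') t = minorIdeal B t := by
  refine le_antisymm (minorIdeal_submatrix_le B e e' t) ?_
  have := minorIdeal_submatrix_le (B.submatrix e e') e.symm e'.symm t
  simpa using this

lemma minorIdeal_transpose (B : Matrix (Fin m) (Fin n) S) (t : ℕ) :
    minorIdeal B.transpose t = minorIdeal B t := by
  have key : ∀ {m n : ℕ} (B : Matrix (Fin m) (Fin n) S),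
      minorIdeal B.transpose t ≤ minorIdeal B t := fun B =>
    minorIdeal_le fun f g _ _ => by
      rw [← Matrix.transpose_submatrix, Matrix.det_transpose]
      exact det_mem_minorIdeal B g f
  exact le_antisymm (key B) (by simpa using key B.transpose)

lemma map_minorIdeal {T : Type*} [CommRing T] (φ : S →+* T) (B : Matrix (Fin m) (Fin n) S)
    (t : ℕ) : (minorIdeal B t).map φ = minorIdeal (B.map φ) t := by
  rw [minorIdeal, minorIdeal, Ideal.map_span, ← Set.range_comp]
  congr 2
  ext1 x
  simp only [Function.comp_apply, RingHom.map_det]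
  rfl

lemma minorIdeal_mul_le {k : ℕ} (P : Matrix (Fin k) (Fin m) S) (B : Matrix (Fin m) (Fin n) S)
    (t : ℕ) : minorIdeal (P * B) t ≤ minorIdeal B t := by
  classical
  refine minorIdeal_le fun f g _ _ => ?_
  have h : (P * B).submatrix f g = fun i => ∑ l, P (f i) l • (B.submatrix id g) l := by
    ext i j
    simp [Matrix.mul_apply]
  have h2 := (Matrix.detRowAlternating (R := S) (n := Fin t)).toMultilinearMap.map_sum
    (fun (i : Fin t) (l : Fin m) => P (f i) l • (B.submatrix id g) l)
  rw [h]
  change (Matrix.detRowAlternating (R := S) (n := Fin t)).toMultilinearMap _ ∈ _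
  rw [h2]
  refine Ideal.sum_mem _ fun κ _ => ?_
  rw [MultilinearMap.map_smul_univ]
  exact Ideal.mul_mem_left _ _ (det_mem_minorIdeal B κ g)

lemma minorIdeal_eq_of_row_op {B C : Matrix (Fin (m + 1)) (Fin n) S} (v : Fin m → S)
    (h0 : ∀ j, C 0 j = B 0 j) (hs : ∀ i j, C i.succ j = v i * B 0 j + B i.succ j) (t : ℕ) :
    minorIdeal C t = minorIdeal B t := by
  have key : ∀ {B C : Matrix (Fin (m + 1)) (Fin n) S} (v : Fin m → S),
      (∀ j, C 0 j = B 0 j) → (∀ i j, C i.succ j = v i * B 0 j + B i.succ j) →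
      minorIdeal C t ≤ minorIdeal B t := by
    intro B C v h0 hs
    let P : Matrix (Fin (m + 1)) (Fin (m + 1)) S := Matrix.of <| Fin.cons (Fin.cons 1 0)
      fun i => Fin.cons (v i) ((1 : Matrix (Fin m) (Fin m) S) i)
    have : C = P * B := by
      ext i j
      rw [Matrix.mul_apply, Fin.sum_univ_succ]
      refine Fin.cases ?_ (fun i => ?_) i
      · simp [P, h0]
      · simp [P, hs, Matrix.one_apply]
    rw [this]
    exact minorIdeal_mul_le P B t
  refine le_antisymm (key v h0 hs) (key (-v) (fun j => (h0 j).symm) fun i j => ?_)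
  rw [hs, h0, Pi.neg_apply]
  ring

lemma minorIdeal_succ_of_blocks {B : Matrix (Fin (m + 1)) (Fin (n + 1)) S} (hu : IsUnit (B 0 0))
    (hr : ∀ j : Fin n, B 0 j.succ = 0) (hc : ∀ i : Fin m, B i.succ 0 = 0) (t : ℕ) :
    minorIdeal B (t + 1) = minorIdeal (B.submatrix Fin.succ Fin.succ) t := by
  have key : ∀ (f : Fin t → Fin (m + 1)) (g : Fin t → Fin (n + 1)), (∀ i, f i ≠ 0) →
      (B.submatrix f g).det ∈ minorIdeal (B.submatrix Fin.succ Fin.succ) t := by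
    intro f g hf
    choose f' hf' using fun i => Fin.exists_succ_eq.mpr (hf i)
    by_cases hg : ∀ j, g j ≠ 0
    · choose g' hg' using fun i => Fin.exists_succ_eq.mpr (hg i)
      obtain rfl : (fun i => (f' i).succ) = f := funext hf'
      obtain rfl : (fun i => (g' i).succ) = g := funext hg'
      exact det_mem_minorIdeal (B.submatrix Fin.succ Fin.succ) f' g'
    · push Not at hg
      obtain ⟨j, hj⟩ := hg
      rw [Matrix.det_eq_zero_of_column_eq_zero j fun i => by
        rw [Matrix.submatrix_apply, hj, ← hf' i, hc]]
      exact zero_mem _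
  refine le_antisymm (minorIdeal_le fun f g hf _ => ?_) (minorIdeal_le fun f g _ _ => ?_)
  · obtain ⟨k, hk⟩ : ∃ k : Fin (t + 1), ∀ i, f (k.succAbove i) ≠ 0 := by
      by_cases h : ∃ k, f k = 0
      · obtain ⟨k, hk⟩ := h
        exact ⟨k, fun i e => k.succAbove_ne i (hf (e.trans hk.symm))⟩
      · push Not at h
        exact ⟨0, fun i => h _⟩
    rw [Matrix.det_succ_row _ k]
    refine Ideal.sum_mem _ fun j _ => Ideal.mul_mem_left _ _ ?_
    exact key (f ∘ k.succAbove) (g ∘ j.succAbove) hk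
  · have h := det_mem_minorIdeal B (Fin.cons 0 (Fin.succ ∘ f) : Fin (t + 1) → _)
      (Fin.cons 0 (Fin.succ ∘ g) : Fin (t + 1) → _)
    rw [Matrix.det_succ_row_zero, Fin.sum_univ_succ, Finset.sum_eq_zero, add_zero] at h
    · simp only [Fin.val_zero, pow_zero, one_mul, Matrix.submatrix_apply, Fin.cons_zero] at h
      exact (Ideal.unit_mul_mem_iff_mem _ hu).mp h
    · intro j _
      simp [hr]

lemma exists_minorIdeal_succ_eq {B : Matrix (Fin (m + 1)) (Fin (n + 1)) S} {i : Fin (m + 1)}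
    {j : Fin (n + 1)} (hu : IsUnit (B i j)) (t : ℕ) :
    ∃ C : Matrix (Fin m) (Fin n) S, minorIdeal B (t + 1) = minorIdeal C t := by
  set B₁ := B.submatrix (Equiv.swap 0 i) (Equiv.swap 0 j) with hB₁
  have hu₁ : IsUnit (B₁ 0 0) := by simpa [hB₁] using hu
  obtain ⟨u, hu₁⟩ := hu₁
  have h1 : (↑u⁻¹ : S) * B₁ 0 0 = 1 := by rw [← hu₁, Units.inv_mul]
  let B₂ : Matrix (Fin (m + 1)) (Fin (n + 1)) S := Matrix.of <| Fin.cons (B₁ 0)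
    fun i j => -(B₁ i.succ 0 * ↑u⁻¹) * B₁ 0 j + B₁ i.succ j
  let B₃ : Matrix (Fin (n + 1)) (Fin (m + 1)) S := Matrix.of <| Fin.cons (B₂.transpose 0)
    fun j i => -(B₁ 0 j.succ * ↑u⁻¹) * B₂.transpose 0 i + B₂.transpose j.succ i
  have e2 : minorIdeal B₂ (t + 1) = minorIdeal B₁ (t + 1) :=
    minorIdeal_eq_of_row_op (fun i => -(B₁ i.succ 0 * ↑u⁻¹)) (fun j => by simp [B₂])
      (fun i j => by simp [B₂]) _
  have e3 : minorIdeal B₃ (t + 1) = minorIdeal B₂.transpose (t + 1) :=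
    minorIdeal_eq_of_row_op (fun j => -(B₁ 0 j.succ * ↑u⁻¹)) (fun j => by simp [B₃])
      (fun i j => by simp [B₃]) _
  have hz : ∀ i : Fin m, B₂ i.succ 0 = 0 := fun i => by
    simp only [B₂, Matrix.of_apply, Fin.cons_succ]
    linear_combination (-B₁ i.succ 0) * h1
  have e4 := minorIdeal_succ_of_blocks (B := B₃) (by simp [B₃, B₂, ← hu₁]) (fun i => by
    simp [B₃, hz]) (fun j => by
    simp only [B₃, B₂, Matrix.of_apply, Fin.cons_succ, Matrix.transpose_apply, Fin.cons_zero]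
    linear_combination (-B₁ 0 j.succ) * h1) t
  refine ⟨(B₃.submatrix Fin.succ Fin.succ).transpose, ?_⟩
  rw [minorIdeal_transpose, ← e4, e3, minorIdeal_transpose, e2, hB₁, minorIdeal_submatrix_equiv]

lemma det_mem_minorIdeal_castLE {k t : ℕ} (B : Matrix (Fin k) (Fin k) S) (h : t ≤ k) :
    B.det ∈ minorIdeal (B.submatrix id (Fin.castLE h)) t := by
  induction k with
  | zero =>
    obtain rfl : t = 0 := by omega
    exact det_mem_minorIdeal (B.submatrix id (Fin.castLE h)) id id
  | succ k ih =>
    rcases h.eq_or_lt with rfl | hlt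
    · exact det_mem_minorIdeal (B.submatrix id (Fin.castLE h)) id id
    · rw [Matrix.det_succ_column B (Fin.last k)]
      refine Ideal.sum_mem _ fun i _ => Ideal.mul_mem_left _ _ ?_
      refine minorIdeal_submatrix_le (B.submatrix id (Fin.castLE h)) i.succAbove id t ?_
      convert ih (B.submatrix i.succAbove (Fin.last k).succAbove) (by omega) using 2
      ext i j
      simp only [Matrix.submatrix_apply, id, Fin.succAbove_last]
      rfl

lemma minor_extMat_mem_minorIdeal (X : Matrix (Fin m) (Fin n) S) {δ : Cols m n} {i : Fin m}
    (hi : (δ.1 i : ℕ) < n) : minor (extMat X) δ ∈ minorIdeal X (i + 1) := by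
  have hlt : ∀ j : Fin (i + 1), (δ.1 (Fin.castLE (by omega) j) : ℕ) < n := fun j =>
    lt_of_le_of_lt (δ.2.monotone (show Fin.castLE _ j ≤ i by rw [Fin.le_def]; simp; omega)) hi
  refine minorIdeal_submatrix_le X id (fun j : Fin (i + 1) => ⟨_, hlt j⟩) (i + 1) ?_
  rw [minor, bracket]
  convert det_mem_minorIdeal_castLE ((extMat X).submatrix id δ.1) (show i + 1 ≤ m by omega) using 2
  ext k j
  simp only [Matrix.submatrix_apply, id]
  exact (extMat_castAdd X k ⟨_, hlt j⟩).symm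

open Classical in
lemma exists_bracket_eq_det (X : Matrix (Fin m) (Fin n) S) {t : ℕ} {f : Fin t → Fin m}
    (hf : Function.Injective f) (g : Fin t → Fin n) :
    ∃ h : Fin m → Fin (n + m), (∀ k, h (f k) = Fin.castAdd m (g k)) ∧
      bracket (extMat X) h = (X.submatrix f g).det := by
  let h : Fin m → Fin (n + m) := fun i =>
    if hi : i ∈ Set.range f then Fin.castAdd m (g hi.choose) else Fin.natAdd n i
  have hfk : ∀ k, h (f k) = Fin.castAdd m (g k) := by
    intro k
    have hk : f k ∈ Set.range f := ⟨k, rfl⟩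
    simp only [h, dif_pos hk]
    rw [hf hk.choose_spec]
  have hnot : ∀ i, i ∉ Set.range f → h i = Fin.natAdd n i := fun i hi => dif_neg hi
  refine ⟨h, hfk, ?_⟩
  rw [bracket, Matrix.twoBlockTriangular_det _ (fun i => i ∉ Set.range f)]
  · have h1 : Matrix.toSquareBlockProp ((extMat X).submatrix id h) (fun i => i ∉ Set.range f) =
        1 := by
      ext i j
      simp only [Matrix.toSquareBlockProp_def, Matrix.of_apply, Matrix.submatrix_apply, id,
        hnot _ j.2, extMat_natAdd, Matrix.one_apply, Subtype.ext_iff]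
    rw [h1, Matrix.det_one, one_mul]
    let e : Fin t ≃ {i // ¬ i ∉ Set.range f} :=
      (Equiv.ofInjective f hf).trans (Equiv.subtypeEquivRight fun i => by simp)
    rw [← Matrix.det_submatrix_equiv_self e]
    congr 1
    ext i j
    simp only [Matrix.submatrix_apply, Matrix.toSquareBlockProp_def, Matrix.of_apply, id]
    change extMat X (f i) (h (f j)) = _
    rw [hfk, extMat_castAdd]
  · intro i hi j hj
    rw [Matrix.submatrix_apply, hnot j hj, extMat_natAdd, id, Matrix.one_apply, if_neg]
    rintro rfl
    exact hi hj

lemma exists_lt_of_range_eq {t : ℕ} {δ : Cols m n} {h : Fin m → Fin (n + m)}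
    (hδ : Set.range δ.1 = Set.range h) {f : Fin t → Fin m} {g : Fin t → Fin n}
    (hg : Function.Injective g) (hfg : ∀ k, h (f k) = Fin.castAdd m (g k)) {i : Fin m}
    (hi : i + 1 = t) : (δ.1 i : ℕ) < n := by
  classical
  by_contra! hcon
  have hsub : (Finset.univ.image fun k => Fin.castAdd m (g k)) ⊆ (Finset.Iio i).image δ.1 := by
    intro x hx
    simp only [Finset.mem_image, Finset.mem_univ, true_and, Finset.mem_Iio] at hx ⊢
    obtain ⟨k, rfl⟩ := hx
    obtain ⟨l, hl⟩ : Fin.castAdd m (g k) ∈ Set.range δ.1 := hδ ▸ ⟨f k, hfg k⟩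
    refine ⟨l, ?_, hl⟩
    rw [← δ.2.lt_iff_lt, hl, Fin.lt_def]
    simp only [Fin.val_castAdd]
    omega
  have h1 := Finset.card_le_card hsub
  rw [Finset.card_image_of_injective _ fun a b e => hg (Fin.castAdd_injective n m e)] at h1
  have h2 := h1.trans Finset.card_image_le
  simp only [Finset.card_univ, Fintype.card_fin, Fin.card_Iio] at h2
  omega

variable (m n) in
/-- The least list of columns with at most `s` entries below `n`. -/
def fewCols (s : ℕ) (hs : s ≤ n) : Cols m n :=
  ⟨fun i => if (i : ℕ) < s then ⟨i, by omega⟩ else ⟨n - s + i, by omega⟩, by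
    intro i j hij
    rw [Fin.lt_def] at hij
    dsimp only
    split_ifs <;> rw [Fin.mk_lt_mk] <;> omega⟩

lemma coe_fewCols (s : ℕ) (hs : s ≤ n) (i : Fin m) :
    ((fewCols m n s hs).1 i : ℕ) = if (i : ℕ) < s then (i : ℕ) else n - s + i := by
  simp only [fewCols]
  split_ifs <;> rfl

lemma not_fewCols_le_iff (i : Fin m) (hs : (i : ℕ) ≤ n) (δ : Cols m n) :
    ¬ fewCols m n i hs ≤ δ ↔ (δ.1 i : ℕ) < n := by
  constructor
  · intro h
    by_contra! hcon
    refine h fun j => ?_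
    rw [Fin.le_def, coe_fewCols]
    split_ifs with hj
    · exact le_strictMono δ.2 j
    · have := strictMono_add_le δ.2 i (j - i) (by omega)
      have e : (⟨i + (j - i), by omega⟩ : Fin m) = j := by ext; simp only; omega
      rw [e] at this
      omega
  · intro h hle
    have := hle i
    rw [Fin.le_def, coe_fewCols, if_neg (lt_irrefl _)] at this
    omega

lemma corank_fewCols (s : ℕ) (hs : s ≤ n) (hm : s ≤ m) :
    corank (fewCols m n s hs) + (m - s) * (n - s) = m * n := by
  have h : ∀ i : Fin m, n + (i : ℕ) - (fewCols m n s hs).1 i = if (i : ℕ) < s then n else s := by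
    intro i
    rw [coe_fewCols]
    split_ifs <;> omega
  obtain ⟨a, rfl⟩ := Nat.exists_eq_add_of_le hm
  obtain ⟨b, rfl⟩ := Nat.exists_eq_add_of_le hs
  rw [corank, Finset.sum_congr rfl fun i _ => h i, Fin.sum_univ_add]
  simp
  ring

theorem minorIdeal_eq_span_minor (X : Matrix (Fin m) (Fin n) S) (i : Fin m) (hs : (i : ℕ) ≤ n) :
    minorIdeal X (i + 1) = Ideal.span (minor (extMat X) '' {x | ¬ fewCols m n i hs ≤ x}) := by
  refine le_antisymm (minorIdeal_le fun f g hf hg => ?_) (Ideal.span_le.mpr ?_)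
  · obtain ⟨h, hfg, e⟩ := exists_bracket_eq_det X hf g
    rw [← e]
    by_cases hh : Function.Injective h
    · obtain ⟨δ, hr, he⟩ := bracket_eq_minor (extMat X) hh
      have hmem : minor (extMat X) δ ∈
          Ideal.span (minor (extMat X) '' {x | ¬ fewCols m n i hs ≤ x}) :=
        Ideal.subset_span ⟨δ, (not_fewCols_le_iff i hs δ).mpr
          (exists_lt_of_range_eq hr hg hfg rfl), rfl⟩
      rcases he with he | he <;> rw [he]
      · exact hmem
      · exact neg_mem hmem
    · rw [bracket_eq_zero_of_not_injective _ hh]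
      exact zero_mem _
  · rintro _ ⟨δ, hδ, rfl⟩
    exact minor_extMat_mem_minorIdeal X ((not_fewCols_le_iff i hs δ).mp hδ)

lemma fewCols_zero : fewCols m n 0 (Nat.zero_le n) = ⊤ := by
  refine Subtype.ext (funext fun i => Fin.ext ?_)
  rw [coe_fewCols, coe_top_cols]
  simp

lemma minorIdeal_one (X : Matrix (Fin m) (Fin n) S) :
    minorIdeal X 1 = Ideal.span (Set.range fun x : Fin m × Fin n => X x.1 x.2) := by
  refine le_antisymm (minorIdeal_le fun f g _ _ => ?_) (Ideal.span_le.mpr ?_)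
  · exact Ideal.subset_span ⟨(f 0, g 0), by simp⟩
  · rintro _ ⟨⟨i, j⟩, rfl⟩
    simpa using det_mem_minorIdeal X (fun _ : Fin 1 => i) (fun _ => j)

end MinorIdeal

section LocalDepth

open RingTheory.Sequence IsLocalRing Module

open scoped Pointwise

universe u

section General

variable {A : Type u} [CommRing A] {J I : Ideal A}

lemma smul_top_quotient_lt (hIJ : I ≤ J) (hJ : J ≠ ⊤) :
    J • (⊤ : Submodule A (A ⧸ I)) < ⊤ := by
  refine lt_top_iff_ne_top.mpr fun h => hJ ?_
  rw [Ideal.eq_top_iff_one]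
  have h1 : (Ideal.Quotient.mk I 1 : A ⧸ I) ∈ J • (⊤ : Submodule A (A ⧸ I)) := by
    rw [h]
    trivial
  have h2 : J • (⊤ : Submodule A (A ⧸ I)) ≤ Submodule.map I.mkQ J := by
    rw [Submodule.smul_le]
    rintro r hr x -
    obtain ⟨x, rfl⟩ := Ideal.Quotient.mk_surjective x
    exact ⟨r * x, Ideal.mul_mem_right _ _ hr, rfl⟩
  obtain ⟨y, hy, hy1⟩ := h2 h1
  have h3 : y - 1 ∈ I := Ideal.Quotient.eq.mp hy1
  have := Submodule.sub_mem _ hy (hIJ h3)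
  rwa [sub_sub_cancel] at this

variable [IsNoetherianRing A]

lemma extVanish_of_isWeaklyRegular (hIJ : I ≤ J) (hJ : J ≠ ⊤) {rs : List A}
    (hmem : ∀ r ∈ rs, r ∈ J) (hreg : IsWeaklyRegular (A ⧸ I) rs) :
    ExtVanish J (A ⧸ I) rs.length := by
  have hlt := smul_top_quotient_lt hIJ hJ
  refine ModuleCat.subsingleton_ext_of_exists_isRegular J (ModuleCat.of A (A ⧸ J)) ?_
    (ModuleCat.of A (A ⧸ I)) hlt rs hmem ⟨hreg, ?_⟩
  · change Module.support A (A ⧸ J) ⊆ _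
    rw [Module.support_eq_zeroLocus, Ideal.annihilator_quotient]
  · refine (ne_top_of_le_ne_top hlt.ne (Submodule.smul_mono_left ?_)).symm
    exact Ideal.span_le.mpr hmem

lemma ExtVanish.exists_isWeaklyRegular (hIJ : I ≤ J) (hJ : J ≠ ⊤) {n : ℕ}
    (h : ExtVanish J (A ⧸ I) n) :
    ∃ rs : List A, rs.length = n ∧ (∀ r ∈ rs, r ∈ J) ∧ IsWeaklyRegular (A ⧸ I) rs := by
  have hlt := smul_top_quotient_lt hIJ hJ
  obtain ⟨rs, h1, h2, h3⟩ := ModuleCat.exists_isRegular_of_exists_subsingleton_ext J n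
    (ModuleCat.of A (A ⧸ I)) hlt (ModuleCat.of A (A ⧸ J)) (by
      change Module.support A (A ⧸ J) = _
      rw [Module.support_eq_zeroLocus, Ideal.annihilator_quotient]) h
  exact ⟨rs, h1, h2, h3.1⟩

end General

variable {B : Type u} [CommRing B]

lemma ringKrullDim_quotient_anti {I J : Ideal B} (h : I ≤ J) :
    ringKrullDim (B ⧸ J) ≤ ringKrullDim (B ⧸ I) :=
  ringKrullDim_le_of_surjective (Ideal.Quotient.factor h) (Ideal.Quotient.factor_surjective h)

lemma ringKrullDim_quotient_add_one_le {p q : Ideal B} [p.IsPrime] (hpq : p ≤ q) {x : B}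
    (hxp : x ∉ p) (hxq : x ∈ q) : ringKrullDim (B ⧸ q) + 1 ≤ ringKrullDim (B ⧸ p) := by
  rw [← supportDim_quotient_eq_ringKrullDim q, ← supportDim_quotient_eq_ringKrullDim p]
  have h1 := supportDim_quotSMulTop_succ_le_of_notMem_minimalPrimes (R := B) (M := B ⧸ p) (x := x)
    (by
      rw [Ideal.annihilator_quotient]
      intro p' hp' hx
      rw [Ideal.minimalPrimes_eq_subsingleton_self] at hp'
      exact hxp (hp' ▸ hx))
  refine le_trans (add_le_add_left ?_ 1) h1
  refine supportDim_le_of_surjective (Submodule.liftQ _ (quotFactor hpq) ?_) ?_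
  · rintro _ ⟨y, -, rfl⟩
    obtain ⟨y, rfl⟩ := Ideal.Quotient.mk_surjective y
    exact Ideal.Quotient.eq_zero_iff_mem.mpr (Ideal.mul_mem_right y _ hxq)
  · intro y
    obtain ⟨y, rfl⟩ := Ideal.Quotient.mk_surjective y
    exact ⟨Submodule.Quotient.mk (Ideal.Quotient.mk p y), rfl⟩

variable [IsNoetherianRing B] [IsLocalRing B]

lemma ringKrullDim_quotient_le_add_one (I : Ideal B) {x : B} (hx : x ∈ maximalIdeal B) :
    ringKrullDim (B ⧸ I) ≤ ringKrullDim (B ⧸ (I ⊔ Ideal.span {x})) + 1 := by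
  rw [← supportDim_quotient_eq_ringKrullDim I, ← supportDim_quotient_eq_ringKrullDim (I ⊔ _)]
  refine (supportDim_le_supportDim_quotSMulTop_succ (M := B ⧸ I) hx).trans (add_le_add_left ?_ 1)
  refine supportDim_le_of_surjective
    (Submodule.liftQ _ ((Submodule.mkQ _).comp (Submodule.mkQ I)) ?_) ?_
  · rw [sup_le_iff, Submodule.span_le, Set.singleton_subset_iff]
    constructor
    · intro y hy
      rw [LinearMap.mem_ker, LinearMap.comp_apply, Submodule.mkQ_apply,
        Submodule.mkQ_apply, (Submodule.Quotient.mk_eq_zero I).mpr hy, Submodule.Quotient.mk_zero]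
    · rw [SetLike.mem_coe, LinearMap.mem_ker, LinearMap.comp_apply, Submodule.mkQ_apply,
        Submodule.Quotient.mk_eq_zero]
      exact ⟨Submodule.Quotient.mk 1, trivial,
        congrArg (Submodule.Quotient.mk (p := I)) (mul_one x)⟩
  · intro y
    obtain ⟨y, rfl⟩ := Submodule.Quotient.mk_surjective _ y
    obtain ⟨y, rfl⟩ := Submodule.Quotient.mk_surjective _ y
    exact ⟨Submodule.Quotient.mk y, rfl⟩

lemma ringKrullDim_quotient_le_add_length (I : Ideal B) {xs : List B}
    (hxs : ∀ x ∈ xs, x ∈ maximalIdeal B) :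
    ringKrullDim (B ⧸ I) ≤ ringKrullDim (B ⧸ (I ⊔ Ideal.ofList xs)) + xs.length := by
  induction xs generalizing I with
  | nil => simpa using ringKrullDim_quotient_anti (by simp)
  | cons x xs ih =>
    rw [List.forall_mem_cons] at hxs
    have h1 := ih (I ⊔ Ideal.span {x}) hxs.2
    rw [Ideal.ofList_cons, ← sup_assoc, List.length_cons, Nat.cast_succ, ← add_assoc]
    exact (ringKrullDim_quotient_le_add_one I hxs.1).trans (add_le_add_left h1 1)

lemma length_le_ringKrullDim_of_isAssociatedPrime {N : Type*} [AddCommGroup N] [Module B N]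
    [Module.Finite B N] {rs : List B} (hrs : ∀ r ∈ rs, r ∈ maximalIdeal B)
    (hreg : IsWeaklyRegular N rs) {p : Ideal B} (hp : IsAssociatedPrime p N) :
    (rs.length : WithBot ℕ∞) ≤ ringKrullDim (B ⧸ p) := by
  have := hp.isPrime
  induction rs generalizing N p with
  | nil =>
    have : Nontrivial (B ⧸ p) := Ideal.Quotient.nontrivial_iff.mpr hp.isPrime.ne_top
    simpa using ringKrullDim_nonneg_of_nontrivial
  | cons x rs ih =>
    rw [List.forall_mem_cons] at hrs
    rw [isWeaklyRegular_cons_iff] at hreg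
    obtain ⟨-, y₀, hy₀⟩ := isAssociatedPrime_iff.mp hp
    have hpy₀ : ∀ r, r ∈ p ↔ r • y₀ = 0 := fun r => by
      rw [hy₀, Submodule.mem_colon_singleton, Submodule.mem_bot]
    let K : Submodule B N := Submodule.torsionBySet B N p
    have hK : ∀ y, y ∈ K ↔ ∀ r ∈ p, r • y = 0 := fun y => by
      simp [K, Submodule.mem_torsionBySet_iff]
    have hxp : x ∉ p := by
      intro hx
      have h0 := hreg.1.right_eq_zero_of_smul ((hpy₀ x).mp hx)
      exact hp.isPrime.ne_top ((Ideal.eq_top_iff_one p).mpr ((hpy₀ 1).mpr (by rw [h0, smul_zero])))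
    obtain ⟨y, hyK, hy⟩ : ∃ y ∈ K, y ∉ x • (⊤ : Submodule B N) := by
      by_contra! hcon
      have hle : K ≤ maximalIdeal B • K := by
        intro y hy
        obtain ⟨z, -, rfl⟩ := hcon y hy
        refine Submodule.smul_mem_smul hrs.1 ((hK z).mpr fun r hr => ?_)
        refine hreg.1.right_eq_zero_of_smul ?_
        rw [smul_comm]
        exact (hK _).mp hy r hr
      have hbot := Submodule.eq_bot_of_le_smul_of_le_jacobson_bot _ K (IsNoetherian.noetherian K)
        hle (maximalIdeal_le_jacobson _)
      have h0 : y₀ = 0 := by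
        rw [← Submodule.mem_bot B, ← hbot, hK]
        exact fun r hr => (hpy₀ r).mp hr
      exact hp.isPrime.ne_top ((Ideal.eq_top_iff_one p).mpr ((hpy₀ 1).mpr (by rw [h0, smul_zero])))
    obtain ⟨q, hq, hle⟩ := exists_le_isAssociatedPrime_of_isNoetherianRing B
      (Submodule.Quotient.mk y : QuotSMulTop x N) (by rwa [Ne, Submodule.Quotient.mk_eq_zero])
    have hpq : p ≤ q := by
      intro r hr
      refine hle ?_
      rw [Submodule.mem_colon_singleton, ← Submodule.Quotient.mk_smul, (hK y).mp hyK r hr]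
      exact zero_mem _
    have hxq : x ∈ q := by
      refine hle ?_
      rw [Submodule.mem_colon_singleton, Submodule.mem_bot, ← Submodule.Quotient.mk_smul,
        Submodule.Quotient.mk_eq_zero]
      exact ⟨y, trivial, rfl⟩
    rw [List.length_cons, Nat.cast_succ]
    exact (add_le_add_left (ih hrs.2 hreg.2 hq hq.isPrime) 1).trans
      (ringKrullDim_quotient_add_one_le hpq hxp hxq)

lemma ExtVanish.quotient_sup_ofList {I : Ideal B} {xs : List B}
    (hxs : ∀ x ∈ xs, x ∈ maximalIdeal B) (hI : I ≤ maximalIdeal B) {n : ℕ}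
    (h : ExtVanish (maximalIdeal B) (B ⧸ I) (n + xs.length))
    (hdim : ringKrullDim (B ⧸ (I ⊔ Ideal.ofList xs)) ≤ n) :
    ExtVanish (maximalIdeal B) (B ⧸ (I ⊔ Ideal.ofList xs)) n := by
  induction xs generalizing I with
  | nil =>
    have e : I ⊔ Ideal.ofList ([] : List B) = I := by simp
    rw [e]
    simpa using h
  | cons x xs ih =>
    rw [List.forall_mem_cons] at hxs
    rw [Ideal.ofList_cons, ← sup_assoc] at hdim ⊢
    rw [List.length_cons] at h
    refine ih hxs.2 (sup_le hI ((Ideal.span_singleton_le_iff_mem _).mpr hxs.1))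
      (h.quotient_sup_of_regular ?_) hdim
    by_contra hcon
    have hx : x ∈ ⋃ p ∈ associatedPrimes B (B ⧸ I), (p : Set B) := by
      rw [biUnion_associatedPrimes_eq_compl_regular, Set.mem_compl_iff]
      intro hx
      refine hcon fun a ha => ?_
      rw [← Ideal.Quotient.eq_zero_iff_mem] at ha ⊢
      exact hx.right_eq_zero_of_smul ha
    simp only [Set.mem_iUnion, exists_prop] at hx
    obtain ⟨p, hp, hxp⟩ := hx
    obtain ⟨rs, hlen, hrs, hreg⟩ := h.exists_isWeaklyRegular hI (maximalIdeal.isMaximal B).ne_top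
    have hIp : I ≤ p := by
      obtain ⟨-, y, rfl⟩ := isAssociatedPrime_iff.mp hp
      obtain ⟨y, rfl⟩ := Ideal.Quotient.mk_surjective y
      intro r hr
      rw [Submodule.mem_colon_singleton, Submodule.mem_bot]
      exact Ideal.Quotient.eq_zero_iff_mem.mpr (Ideal.mul_mem_right y _ hr)
    have h1 := length_le_ringKrullDim_of_isAssociatedPrime hrs hreg hp
    have h2 := ringKrullDim_quotient_le_add_length p hxs.2
    have h3 : ringKrullDim (B ⧸ (p ⊔ Ideal.ofList xs)) ≤ n :=
      (ringKrullDim_quotient_anti (sup_le_sup_right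
        (sup_le hIp ((Ideal.span_singleton_le_iff_mem _).mpr hxp)) _)).trans hdim
    have h4 := (h1.trans h2).trans (add_le_add_left h3 _)
    rw [hlen] at h4
    norm_cast at h4
    omega

end LocalDepth

section Generic

open RingTheory.Sequence MvPolynomial

universe u

lemma isWeaklyRegular_quotient_ker_iff {A T : Type*} [CommRing A] [CommRing T] {φ : A →+* T}
    (hφ : Function.Surjective φ) (rs : List A) :
    IsWeaklyRegular (A ⧸ RingHom.ker φ) rs ↔ IsWeaklyRegular T (rs.map φ) := by
  refine (RingHom.quotientKerEquivOfSurjective hφ).toAddEquiv.isWeaklyRegular_congr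
    (List.forall₂_map_right_iff.mpr (List.forall₂_same.mpr fun r _ x => ?_))
  obtain ⟨x, rfl⟩ := Ideal.Quotient.mk_surjective x
  exact map_mul φ r x

lemma sub_C_eval_mem_span {R σ : Type*} [CommRing R] (a : σ → R) (f : MvPolynomial σ R) :
    f - C (eval a f) ∈ Ideal.span (Set.range fun s => X s - C (a s)) := by
  induction f using MvPolynomial.induction_on with
  | C r => simp
  | add p q hp hq =>
    rw [map_add, map_add, add_sub_add_comm]
    exact add_mem hp hq
  | mul_X p s hp =>
    have e : p * X s - C (eval a (p * X s)) =
        X s * (p - C (eval a p)) + C (eval a p) * (X s - C (a s)) := by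
      rw [map_mul, eval_X, map_mul]
      ring
    rw [e]
    exact add_mem (Ideal.mul_mem_left _ _ hp)
      (Ideal.mul_mem_left _ _ (Ideal.subset_span ⟨s, rfl⟩))

lemma ker_eval {R σ : Type*} [CommRing R] (a : σ → R) :
    RingHom.ker (eval a) = Ideal.span (Set.range fun s => X s - C (a s)) := by
  refine le_antisymm (fun f hf => ?_) (Ideal.span_le.mpr ?_)
  · have := sub_C_eval_mem_span a f
    rwa [RingHom.mem_ker.mp hf, map_zero, sub_zero] at this
  · rintro _ ⟨s, rfl⟩
    simp

lemma eval_surjective {R σ : Type*} [CommRing R] (a : σ → R) :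
    Function.Surjective (eval a) := fun r => ⟨C r, eval_C r⟩

variable {R : Type u} [CommRing R] {m n : ℕ}

lemma span_minor_not_top_le (hm : 0 < m) :
    Ideal.span (minor (extMat (genericMatrix m n R)) '' {x | ¬ ⊤ ≤ x}) =
      RingHom.ker (eval (0 : Fin m × Fin n → R)) := by
  rw [← fewCols_zero, ← minorIdeal_eq_span_minor _ ⟨0, hm⟩, minorIdeal_one, ker_eval]
  simp [genericMatrix]

theorem extVanish_quotient_minorIdeal_generic [IsNoetherianRing R] [Nontrivial R] {P : Ideal R}
    (hP : P ≠ ⊤) {rs : List R} (hmem : ∀ r ∈ rs, r ∈ P) (hreg : IsWeaklyRegular R rs) (i : Fin m)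
    (hs : (i : ℕ) ≤ n) :
    ExtVanish (P.comap (eval (0 : Fin m × Fin n → R)))
      (MvPolynomial (Fin m × Fin n) R ⧸ minorIdeal (genericMatrix m n R) (i + 1))
      (rs.length + corank (fewCols m n i hs)) := by
  have hm : 0 < m := i.pos
  have hli := linearIndependent_stdMon (n := n) R hm
  have htop := minor_extMat_top (genericMatrix m n R)
  have hstr := straightens_minor (extMat (genericMatrix m n R))
  have hgen := adjoin_minor_eq_top (m := m) (n := n) R
  rw [minorIdeal_eq_span_minor _ i hs]
  refine extVanish_of_straightening (minor (extMat (genericMatrix m n R))) corank rs.length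
    (fun Ω₁ Ω₂ h₁ h₂ h₁t h₂t => inf_le_of_straightens hstr htop hgen hli h₁ h₂ h₁t h₂t)
    (fun c hc a ha => mem_of_mul_mem_of_straightens hstr htop hgen hli hc a ha)
    (fun c hc => ?_) (fun a b hab => corank_covBy hab) corank_top ?_ _
  · have : minor (extMat (genericMatrix m n R)) c ∈ RingHom.ker (eval 0) := by
      rw [← span_minor_not_top_le hm]
      exact Ideal.subset_span ⟨c, fun h => hc (top_le_iff.mp h), rfl⟩
    rw [Ideal.mem_comap, RingHom.mem_ker.mp this]
    exact zero_mem _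
  · rw [span_minor_not_top_le hm, ← List.length_map (f := C)]
    refine extVanish_of_isWeaklyRegular ?_ ?_ ?_
      ((isWeaklyRegular_quotient_ker_iff (eval_surjective _) _).mpr ?_)
    · exact Ideal.comap_mono bot_le
    · rwa [Ne, Ideal.comap_eq_top_iff]
    · simpa using hmem
    · simpa [Function.comp_def] using hreg

end Generic

section Localize

open RingTheory.Sequence IsLocalRing

universe u

lemma ExtVanish.localization {A : Type u} [CommRing A] [IsNoetherianRing A] {P I : Ideal A}
    [P.IsPrime] (hIP : I ≤ P) {n : ℕ} (h : ExtVanish P (A ⧸ I) n) :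
    ExtVanish (maximalIdeal (Localization.AtPrime P))
      (Localization.AtPrime P ⧸ I.map (algebraMap A (Localization.AtPrime P))) n := by
  obtain ⟨rs, rfl, hrs, hreg⟩ := h.exists_isWeaklyRegular hIP (Ideal.IsPrime.ne_top ‹_›)
  have h1 := hreg.of_isLocalizedModule (Localization.AtPrime P) P.primeCompl
    (Submodule.toLocalizedQuotient' (Localization.AtPrime P) P.primeCompl
      (Algebra.linearMap A (Localization.AtPrime P)) I)
  rw [Ideal.localized'_eq_map] at h1
  rw [← List.length_map (f := algebraMap A (Localization.AtPrime P))]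
  refine extVanish_of_isWeaklyRegular ?_ (maximalIdeal.isMaximal _).ne_top ?_ h1
  · rw [← Localization.AtPrime.map_eq_maximalIdeal]
    exact Ideal.map_mono hIP
  · simp only [List.mem_map, forall_exists_index, and_imp, forall_apply_eq_imp_iff₂]
    exact fun r hr => (IsLocalization.AtPrime.to_map_mem_maximal_iff _ P r).mpr (hrs r hr)

theorem ExtVanish.exists_isRegular_of_surjective {A T : Type u} [CommRing A] [IsNoetherianRing A]
    [CommRing T] [IsLocalRing T] {ψ : A →+* T} (hψ : Function.Surjective ψ) {I : Ideal A}
    {xs : List A} (hker : RingHom.ker ψ = I ⊔ Ideal.ofList xs) {n : ℕ}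
    (h : ExtVanish ((maximalIdeal T).comap ψ) (A ⧸ I) (n + xs.length))
    (hdim : ringKrullDim T ≤ n) :
    ∃ rs : List T, rs.length = n ∧ (∀ r ∈ rs, r ∈ maximalIdeal T) ∧ IsRegular T rs := by
  let P := (maximalIdeal T).comap ψ
  have hP : P.IsPrime := Ideal.comap_isPrime ψ _
  let B := Localization.AtPrime P
  have hunit : ∀ y : P.primeCompl, IsUnit (ψ y) := fun y => notMem_maximalIdeal.mp y.2
  let φ : B →+* T := IsLocalization.lift hunit
  have hφ : ∀ a, φ (algebraMap A B a) = ψ a := IsLocalization.lift_eq hunit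
  have hφs : Function.Surjective φ := fun y => (hψ y).imp' (algebraMap A B) fun a ha => by
    rw [hφ, ha]
  have hkP : RingHom.ker ψ ≤ P := Ideal.comap_mono bot_le
  have hIP : I ≤ P := (le_sup_left.trans_eq hker.symm).trans hkP
  have hkφ : RingHom.ker φ =
      I.map (algebraMap A B) ⊔ Ideal.ofList (xs.map (algebraMap A B)) := by
    rw [← Ideal.map_ofList, ← Ideal.map_sup, ← hker]
    refine le_antisymm (fun b hb => ?_) (Ideal.map_le_iff_le_comap.mpr fun a ha => ?_)
    · obtain ⟨a, s, rfl⟩ := IsLocalization.exists_mk'_eq P.primeCompl b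
      rw [RingHom.mem_ker, IsLocalization.lift_mk'_spec, mul_zero] at hb
      rw [IsLocalization.mk'_mem_map_algebraMap_iff]
      exact ⟨1, one_mem _, by rwa [one_mul, RingHom.mem_ker]⟩
    · rw [Ideal.mem_comap, RingHom.mem_ker, hφ, RingHom.mem_ker.mp ha]
  have hxs : ∀ x ∈ xs.map (algebraMap A B), x ∈ maximalIdeal B := by
    simp only [List.mem_map, forall_exists_index, and_imp, forall_apply_eq_imp_iff₂]
    refine fun x hx => (IsLocalization.AtPrime.to_map_mem_maximal_iff B P x).mpr (hkP ?_)
    rw [hker]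
    exact Ideal.mem_sup_right (Ideal.subset_span hx)
  have hIB : I.map (algebraMap A B) ≤ maximalIdeal B := by
    rw [← Localization.AtPrime.map_eq_maximalIdeal]
    exact Ideal.map_mono hIP
  have h1 := h.localization hIP
  rw [← List.length_map (f := algebraMap A B)] at h1
  have h2 := h1.quotient_sup_ofList hxs hIB (by
    rwa [← hkφ, ringKrullDim_eq_of_ringEquiv (RingHom.quotientKerEquivOfSurjective hφs)])
  rw [← hkφ] at h2
  obtain ⟨rs, hlen, hrs, hreg⟩ := h2.exists_isWeaklyRegular
    (le_maximalIdeal (RingHom.ker_ne_top φ)) (maximalIdeal.isMaximal B).ne_top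
  have hmem : ∀ r ∈ rs.map φ, r ∈ maximalIdeal T := by
    simp only [List.mem_map, forall_exists_index, and_imp, forall_apply_eq_imp_iff₂]
    have : IsLocalHom φ := hφs.isLocalHom
    have hle : maximalIdeal B ≤ (maximalIdeal T).comap φ := ((local_hom_TFAE φ).out 0 3).mp this
    exact fun r hr => hle (hrs r hr)
  exact ⟨rs.map φ, by simpa using hlen, hmem,
    (isRegular_iff_isWeaklyRegular_of_subset_maximalIdeal hmem).mpr
      ((isWeaklyRegular_quotient_ker_iff hφs rs).mp hreg)⟩

end Localize

section CohenMacaulay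

open RingTheory.Sequence IsLocalRing MvPolynomial

universe u

lemma ringKrullDim_quotient_le_of_le_height {R : Type*} [CommRing R] {I : Ideal R} {h N : ℕ}
    (hdim : ringKrullDim R ≤ (N + h : ℕ))
    (hht : ∀ p : PrimeSpectrum R, I ≤ p.asIdeal → (h : ℕ∞) ≤ Order.height p) :
    ringKrullDim (R ⧸ I) ≤ N := by
  rw [ringKrullDim_quotient]
  refine iSup_le fun l => ?_
  obtain ⟨l', hlast, hlen⟩ := Order.exists_series_of_le_height l.head.1 (hht _ l.head.2)
  have h1 := (Order.LTSeries.length_le_krullDim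
    (l'.smash (l.map Subtype.val (Subtype.strictMono_coe _)) hlast)).trans hdim
  change ((l'.length + l.length : ℕ) : WithBot ℕ∞) ≤ _ at h1
  rw [hlen] at h1
  have h2 : h + l.length ≤ N + h := by exact_mod_cast h1
  exact_mod_cast (by omega : l.length ≤ N)

lemma isCMLocalRing_of_isRegular {T : Type*} [CommRing T] [IsNoetherianRing T] [IsLocalRing T]
    {rs : List T} (hrs : ∀ r ∈ rs, r ∈ maximalIdeal T) (hreg : IsRegular T rs)
    (hdim : ringKrullDim T ≤ rs.length) : IsCMLocalRing T := by
  refine ⟨‹_›, fun M hM => ?_⟩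
  rw [eq_maximalIdeal hM]
  have hle : ∀ rs : List T, IsRegular T rs → (rs.length : WithBot ℕ∞) ≤ ringKrullDim T := by
    intro rs hreg
    rw [← ringKrullDim_add_length_eq_ringKrullDim_of_isRegular rs hreg]
    have : Nontrivial (T ⧸ Ideal.ofList rs) := Ideal.Quotient.nontrivial_iff.mpr fun h =>
      hreg.2 (by rw [h]; simp)
    exact le_add_of_nonneg_left ringKrullDim_nonneg_of_nontrivial
  refine le_antisymm ?_ (hdim.trans ?_)
  · obtain ⟨k, hk⟩ : ∃ k : ℕ∞, ringKrullDim T = k :=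
      ⟨_, (WithBot.coe_unbot _ (ringKrullDim_ne_bot (R := T))).symm⟩
    rw [hk, WithBot.coe_le_coe]
    refine iSup₂_le fun rs h => ?_
    have := hle rs h.2
    rw [hk] at this
    exact_mod_cast this
  · have : (rs.length : ℕ∞) ≤ idealDepth (maximalIdeal T) :=
      le_iSup₂ (f := fun (rs : List T)
        (_ : (∀ x ∈ rs, x ∈ maximalIdeal T) ∧ IsRegular T rs) => (rs.length : ℕ∞)) rs ⟨hrs, hreg⟩
    exact_mod_cast this

lemma exists_isRegular_of_isCMLocalRing {R : Type*} [CommRing R] [IsNoetherianRing R]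
    [IsLocalRing R] (hCM : IsCMLocalRing R) :
    ∃ rs : List R, (∀ r ∈ rs, r ∈ maximalIdeal R) ∧ IsRegular R rs ∧
      ringKrullDim R = rs.length := by
  have h := hCM.2 _ (maximalIdeal.isMaximal R)
  have hfin : idealDepth (maximalIdeal R) < ⊤ := by
    have := ringKrullDim_lt_top (R := R)
    rw [← h] at this
    exact WithBot.coe_lt_coe.mp this
  rw [idealDepth, iSup_subtype'] at hfin h
  have : Nonempty {rs : List R // (∀ x ∈ rs, x ∈ maximalIdeal R) ∧ IsRegular R rs} :=
    ⟨[], by simp, IsRegular.nil R R⟩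
  obtain ⟨rs, hrs⟩ := ENat.exists_eq_iSup_of_lt_top hfin
  refine ⟨rs.1, rs.2.1, rs.2.2, ?_⟩
  rw [← h, ← hrs]
  rfl

theorem isCMLocalRing_quotient_minorIdeal_of_mem {R : Type u} [CommRing R] [IsNoetherianRing R]
    [IsLocalRing R] (hCM : IsCMLocalRing R) {m n : ℕ} {A : Matrix (Fin m) (Fin n) R}
    (hA : ∀ i j, A i j ∈ maximalIdeal R) (i : Fin m) (hi : (i : ℕ) ≤ n)
    (hproper : minorIdeal A (i + 1) ≠ ⊤)
    (hht : ∀ p : PrimeSpectrum R, minorIdeal A (i + 1) ≤ p.asIdeal →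
      (((m - i) * (n - i) : ℕ) : ℕ∞) ≤ Order.height p) :
    IsCMLocalRing (R ⧸ minorIdeal A (i + 1)) := by
  obtain ⟨rs, hrs, hreg, hdimR⟩ := exists_isRegular_of_isCMLocalRing hCM
  have hle : (m - i) * (n - i) ≤ rs.length := by
    have h1 := WithBot.coe_le_coe.mpr
      (hht ⟨maximalIdeal R, inferInstance⟩ (le_maximalIdeal hproper))
    have h2 := (h1.trans (Order.height_le_krullDim _)).trans_eq hdimR
    exact_mod_cast h2
  obtain ⟨N, hN⟩ := Nat.exists_eq_add_of_le' hle
  have : Nontrivial (R ⧸ minorIdeal A (i + 1)) := Ideal.Quotient.nontrivial_iff.mpr hproper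
  have : IsLocalRing (R ⧸ minorIdeal A (i + 1)) :=
    IsLocalRing.of_surjective' _ Ideal.Quotient.mk_surjective
  have hdim : ringKrullDim (R ⧸ minorIdeal A (i + 1)) ≤ N :=
    ringKrullDim_quotient_le_of_le_height (by rw [hdimR, hN]) hht
  let a : Fin m × Fin n → R := fun x => A x.1 x.2
  let ψ := (Ideal.Quotient.mk (minorIdeal A (i + 1))).comp (eval a)
  let xs : List (MvPolynomial (Fin m × Fin n) R) :=
    (Finset.univ : Finset (Fin m × Fin n)).toList.map fun x => X x - C (a x)
  have hxs : Ideal.ofList xs = RingHom.ker (eval a) := by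
    rw [ker_eval, Ideal.ofList]
    congr 1
    ext f
    simp [xs]
  have hmap : (minorIdeal (genericMatrix m n R) (i + 1)).map (eval a) = minorIdeal A (i + 1) := by
    rw [map_minorIdeal]
    congr 1
    ext i j
    simp [genericMatrix, a]
  have hker : RingHom.ker ψ = minorIdeal (genericMatrix m n R) (i + 1) ⊔ Ideal.ofList xs := by
    rw [hxs, ← RingHom.comap_ker, Ideal.mk_ker, ← hmap,
      Ideal.comap_map_of_surjective _ (eval_surjective a)]
    rfl
  have hP : (maximalIdeal (R ⧸ minorIdeal A (i + 1))).comap ψ =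
      (maximalIdeal R).comap (eval (0 : Fin m × Fin n → R)) := by
    have h1 : (maximalIdeal (R ⧸ minorIdeal A (i + 1))).comap (Ideal.Quotient.mk _) =
        maximalIdeal R :=
      eq_maximalIdeal (Ideal.comap_isMaximal_of_surjective _ Ideal.Quotient.mk_surjective)
    rw [← Ideal.comap_comap, h1]
    ext f
    have h2 : eval a f - eval 0 f ∈ maximalIdeal R := by
      have h3 := Ideal.mem_map_of_mem (eval a) (sub_C_eval_mem_span 0 f)
      rw [map_sub, eval_C, Ideal.map_span] at h3
      refine Ideal.span_le.mpr ?_ h3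
      rintro _ ⟨_, ⟨x, rfl⟩, rfl⟩
      simpa using hA x.1 x.2
    rw [Ideal.mem_comap, Ideal.mem_comap]
    exact ⟨fun h => by simpa using sub_mem h h2, fun h => by simpa using add_mem h2 h⟩
  have hext := extVanish_quotient_minorIdeal_generic (m := m) (n := n)
    (maximalIdeal.isMaximal R).ne_top hrs hreg.1 i hi
  have hlen : rs.length + corank (fewCols m n i hi) = N + xs.length := by
    have := corank_fewCols (m := m) i hi i.is_lt.le
    simp only [xs, List.length_map, Finset.length_toList, Finset.card_univ, Fintype.card_prod,
      Fintype.card_fin]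
    omega
  rw [← hP, hlen] at hext
  have hψ : Function.Surjective ψ :=
    Ideal.Quotient.mk_surjective.comp (eval_surjective a)
  obtain ⟨rs', hlen', hmem, hreg'⟩ := hext.exists_isRegular_of_surjective hψ hker hdim
  exact isCMLocalRing_of_isRegular hmem hreg' (by rwa [hlen'])

theorem isCMLocalRing_quotient_minorIdeal {R : Type u} [CommRing R] [IsNoetherianRing R]
    [IsLocalRing R] (hCM : IsCMLocalRing R) {m n t : ℕ} (A : Matrix (Fin m) (Fin n) R)
    (hm : t < m) (hn : t < n) (hproper : minorIdeal A (t + 1) ≠ ⊤)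
    (hht : ∀ p : PrimeSpectrum R, minorIdeal A (t + 1) ≤ p.asIdeal →
      (((m - t) * (n - t) : ℕ) : ℕ∞) ≤ Order.height p) :
    IsCMLocalRing (R ⧸ minorIdeal A (t + 1)) := by
  induction t generalizing m n with
  | zero =>
    refine isCMLocalRing_quotient_minorIdeal_of_mem hCM (fun i j => ?_) ⟨0, hm⟩ n.zero_le hproper
      hht
    by_contra h
    rw [notMem_maximalIdeal] at h
    refine hproper (Ideal.eq_top_of_isUnit_mem _ ?_ h)
    rw [zero_add, minorIdeal_one]
    exact Ideal.subset_span ⟨(i, j), rfl⟩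
  | succ t ih =>
    by_cases hA : ∀ i j, A i j ∈ maximalIdeal R
    · exact isCMLocalRing_quotient_minorIdeal_of_mem hCM hA ⟨t + 1, hm⟩ hn.le hproper hht
    push Not at hA
    obtain ⟨i, j, hij⟩ := hA
    rw [notMem_maximalIdeal] at hij
    obtain ⟨m, rfl⟩ := Nat.exists_eq_succ_of_ne_zero (Nat.ne_zero_of_lt hm)
    obtain ⟨n, rfl⟩ := Nat.exists_eq_succ_of_ne_zero (Nat.ne_zero_of_lt hn)
    obtain ⟨B, hB⟩ := exists_minorIdeal_succ_eq hij (t + 1)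
    rw [hB] at hproper hht ⊢
    refine ih B (by omega) (by omega) hproper fun p hp => ?_
    rw [← Nat.add_sub_add_right m 1 t, ← Nat.add_sub_add_right n 1 t]
    exact hht p hp

end CohenMacaulay

end DetCM

/-- If `R` is a Noetherian Cohen–Macaulay local ring, `A` is an `m × n` matrix over `R`,
`1 ≤ t ≤ min m n`, and `I_t(A)` is a proper ideal whose height (the infimum of the heights
of the primes containing it) equals `(m - t + 1) * (n - t + 1)`, then `R / I_t(A)` is a
Cohen–Macaulay local ring. -/
theorem isCMLocalRing_quotient_detIdeal
    {R : Type*} [CommRing R] [IsNoetherianRing R] (hCM : IsCMLocalRing R)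
    {m n : ℕ} (hm : 1 ≤ m) (hn : 1 ≤ n) (A : Matrix (Fin m) (Fin n) R)
    (t : ℕ) (ht1 : 1 ≤ t) (ht2 : t ≤ min m n)
    (hproper : detIdeal A (t : ℤ) ≠ ⊤)
    (hht : (⨅ (p : PrimeSpectrum R) (_ : detIdeal A (t : ℤ) ≤ p.asIdeal), Order.height p) =
      ((m - t + 1) * (n - t + 1) : ℕ)) :
    IsCMLocalRing (R ⧸ detIdeal A (t : ℤ)) := by
  have := hCM.1
  obtain ⟨s, rfl⟩ := Nat.exists_eq_add_of_le' ht1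
  have h1 : m - s = m - (s + 1) + 1 := by omega
  have h2 : n - s = n - (s + 1) + 1 := by omega
  rw [DetCM.detIdeal_eq_minorIdeal] at hproper hht ⊢
  refine DetCM.isCMLocalRing_quotient_minorIdeal hCM A (by omega) (by omega) hproper ?_
  rw [h1, h2, ← le_iInf₂_iff]
  exact hht.ge
end

section
/- Let F be a field, let m, n ≥ 1, let R = MvPolynomial (Fin m × Fin n) F be the polynomial ring in mn variables x_{ij}, and let X be the generic m×n matrix over R whose (i,j) entry is the variable x_{ij}. Then for every integer t with 1 ≤ t ≤ min(m,n), the determinantal ideal I_t(X) has height exactly (m − t + 1)(n − t + 1); equivalently, the Krull dimension of R/I_t(X) equals mn − (m − t + 1)(n − t + 1). -/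
universe u v

theorem ringKrullDim_le_of_isIntegral_of_injective {R S : Type*} [CommRing R] [CommRing S]
    [IsDomain S] [Algebra R S] [Algebra.IsIntegral R S] [FaithfulSMul R S] :
    ringKrullDim R ≤ ringKrullDim S := by
  refine iSup_le fun l => ?_
  obtain ⟨P, hP, hPl⟩ := Ideal.exists_ideal_over_prime_of_isIntegral_of_isDomain
    (S := S) l.head.asIdeal
    (by
      rw [(RingHom.injective_iff_ker_eq_bot _).mp (FaithfulSMul.algebraMap_injective R S)]
      exact bot_le)
  have : P.LiesOver l.head.asIdeal := ⟨hPl.symm⟩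
  obtain ⟨L, hL, -⟩ := Ideal.exists_ltSeries_of_hasGoingUp l P
  rw [← hL]
  exact le_iSup (fun L : LTSeries (PrimeSpectrum S) => (L.length : WithBot ℕ∞)) L

theorem AlgebraicIndependent.natCard_le_ringKrullDim {F A ι : Type*} [Field F] [CommRing A]
    [IsDomain A] [Algebra F A] [Algebra.FiniteType F A] [Finite ι] {x : ι → A}
    (hx : AlgebraicIndependent F x) : (Nat.card ι : WithBot ℕ∞) ≤ ringKrullDim A := by
  obtain ⟨s, g, hg, hint⟩ := exists_integral_inj_algHom_of_fg F A
  algebraize [g.toRingHom]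
  have : IsScalarTower F (MvPolynomial (Fin s) F) A := .of_algHom g
  have : FaithfulSMul (MvPolynomial (Fin s) F) A :=
    (faithfulSMul_iff_algebraMap_injective _ _).mpr hg
  have hdim := ringKrullDim_le_of_isIntegral_of_injective (R := MvPolynomial (Fin s) F) (S := A)
  rw [MvPolynomial.ringKrullDim_of_isNoetherianRing, ringKrullDim_eq_zero_of_field, zero_add,
    Nat.card_fin] at hdim
  refine le_trans ?_ hdim
  have htr := lift_trdeg_add_eq F (MvPolynomial (Fin s) F) A
  rw [MvPolynomial.trdeg_of_isDomain, trdeg_eq_zero] at htr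
  have hle := hx.lift_cardinalMk_le_trdeg
  rw [← Nat.cast_card] at hle
  simp only [Cardinal.mk_fin, Cardinal.lift_natCast, Cardinal.lift_zero, add_zero] at htr hle
  rw [eq_comm, Cardinal.lift_eq_nat_iff] at htr
  rw [htr, Cardinal.lift_natCast] at hle
  exact_mod_cast hle

theorem Ideal.add_le_ringKrullDim {R : Type*} [CommRing R] (I : Ideal R)
    {h d : ℕ} (hh : ∀ p : PrimeSpectrum R, I ≤ p.asIdeal → (h : ℕ∞) ≤ Order.height p)
    (hd : (d : WithBot ℕ∞) ≤ ringKrullDim (R ⧸ I)) :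
    ((h + d : ℕ) : WithBot ℕ∞) ≤ ringKrullDim R := by
  rw [ringKrullDim_quotient] at hd
  obtain ⟨l, hl⟩ := Order.le_krullDim_iff.mp hd
  let L : LTSeries (PrimeSpectrum R) := l.map Subtype.val (Subtype.strictMono_coe _)
  have hhead := hh L.head l.head.2
  have hcoh : (d : ℕ∞) ≤ Order.coheight L.head := by
    rw [← hl]
    exact Order.length_le_coheight_head (p := L)
  have : Nonempty (PrimeSpectrum R) := ⟨L.head⟩
  rw [ringKrullDim, Order.krullDim_eq_iSup_height_add_coheight_of_nonempty]
  norm_cast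
  push_cast
  exact (add_le_add hhead hcoh).trans
    (le_iSup (fun p : PrimeSpectrum R => Order.height p + Order.coheight p) L.head)

theorem RingHom.Flat.height_comap_le {R S : Type*} [CommRing R] [CommRing S] [IsNoetherianRing R]
    [IsNoetherianRing S] {f : R →+* S} (hf : f.Flat) (P : Ideal S) [P.IsPrime] :
    (P.comap f).height ≤ P.height := by
  algebraize [f]
  have : P.LiesOver (P.comap f) := ⟨rfl⟩
  rw [Ideal.height_eq_height_add_of_liesOver_of_hasGoingDown (P.comap f) P]
  exact le_self_add

theorem Matrix.det_fromBlocks_unit_of_mul_eq_one {L n : Type*} [CommRing L] [Fintype n] [DecidableEq n]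
    {x u : L} (h : x * u = 1) (b c : n → L) (D : Matrix n n L) :
    (fromBlocks (of fun _ _ : Unit => x) (of fun _ j => b j) (of fun i _ => c i) D).det =
      x * (of fun i j => D i j - u * c i * b j).det := by
  let _ : Invertible (of fun _ _ : Unit => x) :=
    ⟨of fun _ _ => u, by ext; simp [mul_apply, mul_comm u, h], by ext; simp [mul_apply, h]⟩
  have hinv : ⅟(of fun _ _ : Unit => x) = of fun _ _ => u := rfl
  rw [det_fromBlocks₁₁, hinv]
  congr 1
  · simp
  · congr 1
    ext i j
    simp [mul_apply, mul_comm u]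

theorem Matrix.det_mul_eq_zero_of_card_lt {K m n : Type*} [Field K] [Fintype m] [DecidableEq m]
    [Fintype n] (h : Fintype.card n < Fintype.card m) (A : Matrix m n K) (B : Matrix n m K) :
    (A * B).det = 0 := by
  by_contra hdet
  have h1 := rank_of_isUnit (A * B) ((isUnit_iff_isUnit_det _).mpr (Ne.isUnit hdet))
  have h2 := (rank_mul_le_left A B).trans (rank_le_card_width A)
  omega

namespace MvPolynomial

theorem card_le_height_of_forall_X_mem {F σ : Type*} [Field F] [Fintype σ]
    (P : Ideal (MvPolynomial σ F)) [P.IsPrime] (hP : ∀ i, X i ∈ P) :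
    (Fintype.card σ : ℕ∞) ≤ P.height := by
  classical
  let φ (s : Finset σ) : MvPolynomial σ F →ₐ[F] MvPolynomial σ F :=
    aeval fun i => if i ∈ s then 0 else X i
  have key : ∀ s : Finset σ, (s.card : ℕ∞) ≤ (RingHom.ker (φ s)).height := by
    intro s
    induction s using Finset.induction_on with
    | empty => simp
    | insert a s ha ih =>
      have := RingHom.ker_isPrime (φ s).toRingHom
      have := RingHom.ker_isPrime (φ (insert a s)).toRingHom
      have hcomp : (φ (insert a s)).comp (φ s) = φ (insert a s) := by
        ext i : 1
        by_cases hi : i ∈ s <;> simp [φ, hi]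
      have hlt : RingHom.ker (φ s) < RingHom.ker (φ (insert a s)) := by
        refine SetLike.lt_iff_le_and_exists.mpr ⟨fun p hp => ?_, X a, ?_, ?_⟩
        · rw [RingHom.mem_ker] at hp ⊢
          rw [← hcomp, AlgHom.comp_apply, hp, map_zero]
        · simp [φ]
        · simp [φ, ha]
      have := Ideal.height_add_one_le_of_lt_of_isPrime
        (I := RingHom.ker (φ s).toRingHom) (J := RingHom.ker (φ (insert a s)).toRingHom) hlt
      rw [Finset.card_insert_of_notMem ha]
      push_cast
      exact (add_le_add_left ih 1).trans this
  refine (key Finset.univ).trans (Ideal.height_mono fun p hp => ?_)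
  have hcomp : (Ideal.Quotient.mkₐ F P).comp (φ Finset.univ) = Ideal.Quotient.mkₐ F P := by
    ext i : 1
    simpa [φ] using (Ideal.Quotient.eq_zero_iff_mem.mpr (hP i)).symm
  rw [RingHom.mem_ker] at hp
  rw [← Ideal.Quotient.eq_zero_iff_mem, ← Ideal.Quotient.mkₐ_eq_mk F, ← hcomp,
    AlgHom.comp_apply, hp, map_zero]

theorem flat_rename {R σ τ : Type*} [CommRing R] {f : σ → τ}
    (hf : Function.Injective f) : (rename f : MvPolynomial σ R →ₐ[R] _).toRingHom.Flat := by
  classical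
  let e : σ ⊕ {x // ¬ x ∈ Set.range f} ≃ τ :=
    (Equiv.sumCongr (Equiv.ofInjective f hf) (Equiv.refl _)).trans
      (Equiv.sumCompl (· ∈ Set.range f))
  let E : MvPolynomial {x // ¬ x ∈ Set.range f} (MvPolynomial σ R) ≃ₐ[R] MvPolynomial τ R :=
    ((sumAlgEquiv R _ _).symm.trans (renameEquiv R (Equiv.sumComm _ _))).trans (renameEquiv R e)
  have : (rename f : MvPolynomial σ R →ₐ[R] _).toRingHom = E.toRingEquiv.toRingHom.comp C := by
    refine MvPolynomial.ringHom_ext (fun r => ?_) (fun i => ?_)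
    · simp [E]
    · simp [E, e]
  rw [this]
  exact RingHom.Flat.comp (RingHom.flat_algebraMap_iff.mpr inferInstance)
    (RingHom.Flat.of_bijective E.bijective)

/-- The polynomial ring in the entries of a generic matrix, with the `(a, b)` entry inverted. -/
abbrev PivotLocalization (F : Type*) [Field F] {α β : Type*} (a : α) (b : β) :=
  Localization.Away (X (a, b) : MvPolynomial (α × β) F)

namespace PivotLocalization

variable (F : Type*) [Field F] {α β : Type*} (a : α) (b : β)

/-- The image of a variable in `PivotLocalization F a b`. -/
noncomputable def var (p : α × β) : PivotLocalization F a b :=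
  algebraMap (MvPolynomial (α × β) F) _ (X p)

/-- The inverse of the `(a, b)` entry in `PivotLocalization F a b`. -/
noncomputable def inv : PivotLocalization F a b :=
  IsLocalization.Away.invSelf (X (a, b) : MvPolynomial (α × β) F)

theorem var_mul_inv : var F a b (a, b) * inv F a b = 1 :=
  IsLocalization.Away.mul_invSelf _

theorem isUnit_var : IsUnit (var F a b (a, b)) :=
  IsUnit.of_mul_eq_one _ (var_mul_inv F a b)

variable [DecidableEq α] [DecidableEq β]

/-- The substitution adding to every entry outside the `a`-th row and the `b`-th column the
multiple `c * x i b * x a j / x a b`. -/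
noncomputable def pivotHom (c : F) : PivotLocalization F a b →ₐ[F] PivotLocalization F a b :=
  IsLocalization.liftAlgHom (M := Submonoid.powers (X (a, b) : MvPolynomial (α × β) F))
    (f := aeval fun p => if p.1 = a ∨ p.2 = b then var F a b p else
      var F a b p + c • (inv F a b * var F a b (p.1, b) * var F a b (a, p.2)))
    (by
      rintro ⟨_, k, rfl⟩
      simp only [map_pow, aeval_X, true_or, if_true]
      exact (isUnit_var F a b).pow k)

variable {F a b}

theorem pivotHom_var (c : F) (p : α × β) :
    pivotHom F a b c (var F a b p) = if p.1 = a ∨ p.2 = b then var F a b p else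
      var F a b p + c • (inv F a b * var F a b (p.1, b) * var F a b (a, p.2)) := by
  rw [pivotHom, IsLocalization.coe_liftAlgHom, var, IsLocalization.lift_eq]
  exact aeval_X _ p

theorem pivotHom_inv (c : F) : pivotHom F a b c (inv F a b) = inv F a b := by
  have h := var_mul_inv F a b
  have h' := congrArg (pivotHom F a b c) h
  rw [map_mul, map_one, pivotHom_var, if_pos (Or.inl rfl)] at h'
  exact (isUnit_var F a b).mul_left_cancel (h'.trans h.symm)

theorem pivotHom_pivotHom_neg (c : F) (x : PivotLocalization F a b) :
    pivotHom F a b c (pivotHom F a b (-c) x) = x := by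
  have : (pivotHom F a b c).comp (pivotHom F a b (-c)) = AlgHom.id F _ := by
    refine IsLocalization.algHom_ext (Submonoid.powers (X (a, b) : MvPolynomial (α × β) F)) ?_
    ext p : 1
    change pivotHom F a b c (pivotHom F a b (-c) (var F a b p)) = var F a b p
    by_cases hp : p.1 = a ∨ p.2 = b
    · simp [pivotHom_var, hp]
    · simp [pivotHom_var, pivotHom_inv, hp]
  exact DFunLike.congr_fun this x

theorem pivotHom_bijective (c : F) : Function.Bijective (pivotHom F a b c) :=
  Function.bijective_iff_has_inverse.mpr ⟨pivotHom F a b (-c),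
    fun x => by simpa using pivotHom_pivotHom_neg (-c) x, pivotHom_pivotHom_neg c⟩

variable (F a b) in
/-- The homomorphism sending the generic matrix without the row `a` and the column `b` to the
Schur complement of the `(a, b)` entry. -/
noncomputable def schurHom :
    MvPolynomial ({i : α // i ≠ a} × {j : β // j ≠ b}) F →+* PivotLocalization F a b :=
  ((pivotHom F a b (-1)).toRingHom.comp (algebraMap (MvPolynomial (α × β) F) _)).comp
    (rename (Prod.map Subtype.val Subtype.val)).toRingHom

theorem schurHom_X (p : {i : α // i ≠ a} × {j : β // j ≠ b}) :
    schurHom F a b (X p) = var F a b (p.1, p.2) -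
      inv F a b * var F a b (p.1, b) * var F a b (a, p.2) := by
  change pivotHom F a b (-1) (algebraMap (MvPolynomial (α × β) F) _ (rename _ (X p))) = _
  rw [rename_X]
  refine (pivotHom_var (-1) _).trans ?_
  rw [if_neg (by simpa using ⟨p.1.2, p.2.2⟩)]
  simp [sub_eq_add_neg, Prod.map]

theorem flat_schurHom : (schurHom F a b).Flat := by
  refine RingHom.Flat.comp
    (flat_rename (Function.Injective.prodMap Subtype.val_injective Subtype.val_injective))
    (RingHom.Flat.comp (RingHom.flat_algebraMap_iff.mpr ?_)
      (RingHom.Flat.of_bijective (pivotHom_bijective (-1))))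
  exact IsLocalization.flat _ (Submonoid.powers (X (a, b) : MvPolynomial (α × β) F))

theorem var_mul_schurHom_det {r : ℕ} (f : Fin r → {i : α // i ≠ a})
    (g : Fin r → {j : β // j ≠ b}) :
    var F a b (a, b) * schurHom F a b (Matrix.of fun i j => X (f i, g j)).det =
      algebraMap (MvPolynomial (α × β) F) _ (Matrix.of fun (i j : Unit ⊕ Fin r) =>
        X (i.elim (fun _ => a) (fun i => (f i : α)),
          j.elim (fun _ => b) (fun j => (g j : β)))).det := by
  rw [RingHom.map_det, RingHom.map_det]
  have h := Matrix.det_fromBlocks_unit_of_mul_eq_one (var_mul_inv F a b)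
    (fun j => var F a b (a, g j)) (fun i => var F a b (f i, b))
    (Matrix.of fun i j : Fin r => var F a b (f i, g j))
  convert! h.symm using 1
  · congr 2
    ext i j
    simp [schurHom_X]
  · congr 1
    ext (i | i) (j | j) <;> rfl

end PivotLocalization

theorem le_height_of_minors_mem {F : Type*} [Field F] {α : Type u} {β : Type v}
    [Fintype α] [Fintype β] (r : ℕ) (P : Ideal (MvPolynomial (α × β) F)) [P.IsPrime]
    (hP : ∀ (f : Fin (r + 1) → α) (g : Fin (r + 1) → β),
      (Matrix.of fun i j => (X (f i, g j) : MvPolynomial (α × β) F)).det ∈ P) :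
    (((Fintype.card α - r) * (Fintype.card β - r) : ℕ) : ℕ∞) ≤ P.height := by
  classical
  induction r generalizing α β with
  | zero =>
    have hX : ∀ p, X p ∈ P := fun p => by simpa using hP (fun _ => p.1) (fun _ => p.2)
    simpa using card_le_height_of_forall_X_mem P hX
  | succ r ih =>
  by_cases hX : ∀ p, X p ∈ P
  · refine le_trans ?_ (card_le_height_of_forall_X_mem P hX)
    rw [Fintype.card_prod]
    exact_mod_cast Nat.mul_le_mul (Nat.sub_le _ _) (Nat.sub_le _ _)
  push Not at hX
  obtain ⟨⟨a, b⟩, hab⟩ := hX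
  let L := PivotLocalization F a b
  let P' : Ideal L := P.map (algebraMap _ L)
  have hdisj : Disjoint (Submonoid.powers (X (a, b) : MvPolynomial (α × β) F) : Set _)
      (P : Set (MvPolynomial (α × β) F)) :=
    (Ideal.disjoint_powers_iff_notMem _ (Ideal.IsPrime.isRadical ‹_›)).mpr hab
  have : P'.IsPrime := IsLocalization.isPrime_of_isPrime_disjoint _ L P ‹_› hdisj
  have hheight : P'.height = P.height := IsLocalization.height_map_of_disjoint _ P hdisj
  have : IsNoetherianRing L := IsLocalization.isNoetherianRing
    (Submonoid.powers (X (a, b) : MvPolynomial (α × β) F)) L inferInstance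
  have hQ := ih (P'.comap (PivotLocalization.schurHom F a b)) fun f g => by
    let e : Unit ⊕ Fin (r + 1) ≃ Fin (r + 1 + 1) := Fintype.equivOfCardEq (by simp [add_comm])
    rw [Ideal.mem_comap,
      ← Ideal.unit_mul_mem_iff_mem P' (PivotLocalization.isUnit_var F a b),
      PivotLocalization.var_mul_schurHom_det]
    refine Ideal.mem_map_of_mem _ ?_
    convert hP (fun i => (e.symm i).elim (fun _ => a) (fun i => (f i : α)))
      (fun j => (e.symm j).elim (fun _ => b) (fun j => (g j : β))) using 1
    rw [← Matrix.det_submatrix_equiv_self e.symm]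
    rfl
  rw [← hheight]
  refine le_trans ?_ (hQ.trans (PivotLocalization.flat_schurHom.height_comap_le P'))
  simp only [ne_eq, Fintype.card_subtype_compl, Fintype.card_unique, Nat.sub_sub, add_comm 1 r]
  exact le_rfl

/-- The product of the first columns, the inverse of the leading block and the first rows of the
generic matrix, where the leading block is given by the injections `a` and `b`: it agrees with the
generic matrix in these rows and columns. -/
noncomputable def rankCompletion (F : Type*) [Field F] {α β ι : Type*} [Fintype ι] [DecidableEq ι]
    (a : ι → α) (b : ι → β) : Matrix α β (FractionRing (MvPolynomial (α × β) F)) :=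
  let M : Matrix α β (FractionRing (MvPolynomial (α × β) F)) :=
    Matrix.of fun i j => algebraMap (MvPolynomial (α × β) F) _ (X (i, j))
  M.submatrix id b * (M.submatrix a b)⁻¹ * M.submatrix a id

section rankCompletion

variable {F : Type*} [Field F] {α β ι : Type*} [Fintype ι] [DecidableEq ι] {a : ι → α} {b : ι → β}

theorem rankCompletion_submatrix_det_eq_zero {κ : Type*} [Fintype κ] [DecidableEq κ]
    (h : Fintype.card ι < Fintype.card κ) (f : κ → α) (g : κ → β) :
    ((rankCompletion F a b).submatrix f g).det = 0 := by
  rw [rankCompletion, Matrix.submatrix_mul _ _ f id g Function.bijective_id]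
  exact Matrix.det_mul_eq_zero_of_card_lt h _ _

theorem rankCompletion_apply (ha : Function.Injective a) (hb : Function.Injective b) {i : α} {j : β}
    (hij : i ∈ Set.range a ∨ j ∈ Set.range b) :
    rankCompletion F a b i j = algebraMap (MvPolynomial (α × β) F) _ (X (i, j)) := by
  set M : Matrix α β (FractionRing (MvPolynomial (α × β) F)) :=
    Matrix.of fun i j => algebraMap (MvPolynomial (α × β) F) _ (X (i, j))
  have hA : IsUnit (M.submatrix a b).det := by
    have hinj : Function.Injective ((algebraMap (MvPolynomial (α × β) F)
        (FractionRing (MvPolynomial (α × β) F))).comp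
          (rename (R := F) (Prod.map a b)).toRingHom) :=
      (IsFractionRing.injective _ _).comp (rename_injective _ (ha.prodMap hb))
    have hdet := (map_ne_zero_iff _ hinj).mpr (Matrix.det_mvPolynomialX_ne_zero ι F)
    rw [RingHom.map_det] at hdet
    rw [show M.submatrix a b = RingHom.mapMatrix _ (Matrix.mvPolynomialX ι ι F) from ?_]
    · exact hdet.isUnit
    · ext i j
      simp [M]
  change (M.submatrix id b * (M.submatrix a b)⁻¹ * M.submatrix a id) i j = M i j
  rcases hij with ⟨k, rfl⟩ | ⟨k, rfl⟩
  · change ((M.submatrix id b * (M.submatrix a b)⁻¹ * M.submatrix a id).submatrix a id) k j = _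
    rw [Matrix.submatrix_mul _ _ a id id Function.bijective_id,
      Matrix.submatrix_mul _ _ a id id Function.bijective_id]
    change ((M.submatrix a b * (M.submatrix a b)⁻¹) * M.submatrix a id) k j = _
    rw [Matrix.mul_nonsing_inv _ hA, Matrix.one_mul]
    rfl
  · change ((M.submatrix id b * (M.submatrix a b)⁻¹ * M.submatrix a id).submatrix id b) i k = _
    rw [Matrix.submatrix_mul _ _ id id b Function.bijective_id]
    change ((M.submatrix id b * (M.submatrix a b)⁻¹) * M.submatrix a b) i k = _
    rw [Matrix.mul_assoc, Matrix.nonsing_inv_mul _ hA, Matrix.mul_one]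
    rfl

end rankCompletion

theorem le_ringKrullDim_quotient_of_minors {F : Type*} [Field F] {α β : Type*}
    [Fintype α] [Fintype β] {r : ℕ} (hα : r ≤ Fintype.card α) (hβ : r ≤ Fintype.card β)
    (I : Ideal (MvPolynomial (α × β) F))
    (hI : I ≤ Ideal.span {d | ∃ (f : Fin (r + 1) → α) (g : Fin (r + 1) → β),
      d = (Matrix.of fun i j => (X (f i, g j) : MvPolynomial (α × β) F)).det}) :
    ((Fintype.card α * Fintype.card β - (Fintype.card α - r) * (Fintype.card β - r) : ℕ) :
      WithBot ℕ∞) ≤ ringKrullDim (MvPolynomial (α × β) F ⧸ I) := by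
  classical
  obtain ⟨a⟩ : Nonempty (Fin r ↪ α) := Function.Embedding.nonempty_of_card_le (by simpa)
  obtain ⟨b⟩ : Nonempty (Fin r ↪ β) := Function.Embedding.nonempty_of_card_le (by simpa)
  let φ : MvPolynomial (α × β) F →ₐ[F] FractionRing (MvPolynomial (α × β) F) :=
    aeval fun p => rankCompletion F a b p.1 p.2
  have hIφ : I ≤ RingHom.ker φ := by
    refine hI.trans (Ideal.span_le.mpr ?_)
    rintro _ ⟨f, g, rfl⟩
    have := rankCompletion_submatrix_det_eq_zero (F := F) (a := a) (b := b) (by simp) f g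
    rw [SetLike.mem_coe, RingHom.mem_ker, AlgHom.map_det, ← this]
    congr 1
    ext i j
    simp [φ]
  let D : Finset (α × β) := ((Finset.univ.map a)ᶜ ×ˢ (Finset.univ.map b)ᶜ)ᶜ
  have hD : Nat.card D =
      Fintype.card α * Fintype.card β - (Fintype.card α - r) * (Fintype.card β - r) := by
    rw [Nat.card_eq_fintype_card, Fintype.card_coe, Finset.card_compl]
    simp [Finset.card_compl]
  have : (RingHom.ker φ).IsPrime := RingHom.ker_isPrime φ
  have hind : AlgebraicIndependent F
      fun p : D => Ideal.Quotient.mkₐ F (RingHom.ker φ) (X (p : α × β)) := by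
    refine AlgebraicIndependent.of_comp (Ideal.kerLiftAlg φ) ?_
    have hX := ((algebraicIndependent_X (α × β) F).map' (f := Algebra.ofId (MvPolynomial (α × β) F)
      (FractionRing (MvPolynomial (α × β) F)) |>.restrictScalars F)
      (IsFractionRing.injective _ _)).comp ((↑) : D → α × β) Subtype.val_injective
    convert hX using 1
    ext ⟨⟨i, j⟩, hp⟩
    refine (aeval_X _ _).trans (rankCompletion_apply a.injective b.injective ?_)
    simpa [D, or_iff_not_imp_left] using hp
  rw [← hD]
  exact hind.natCard_le_ringKrullDim.trans
    (ringKrullDim_le_of_surjective _ (Ideal.Quotient.factor_surjective hIφ))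

end MvPolynomial

/-- Over the polynomial ring `R = F[x_{ij}]` in `m * n` variables over a field `F`, with
`X` the generic `m × n` matrix whose `(i, j)` entry is the variable `x_{ij}`, and
`1 ≤ t ≤ min m n`, the determinantal ideal `I_t(X)` has height exactly
`(m - t + 1) * (n - t + 1)`; equivalently, the Krull dimension of `R / I_t(X)` equals
`m * n - (m - t + 1) * (n - t + 1)`. -/
theorem height_detIdeal_genericMatrix
    (F : Type*) [Field F] {m n : ℕ} (hm : 1 ≤ m) (hn : 1 ≤ n)
    (t : ℕ) (ht1 : 1 ≤ t) (ht2 : t ≤ min m n) :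
    letI R := MvPolynomial (Fin m × Fin n) F
    letI X : Matrix (Fin m) (Fin n) R := Matrix.of fun i j => MvPolynomial.X (i, j)
    (⨅ (p : PrimeSpectrum R) (_ : detIdeal X (t : ℤ) ≤ p.asIdeal), Order.height p) =
        ((m - t + 1) * (n - t + 1) : ℕ) ∧
      ringKrullDim (R ⧸ detIdeal X (t : ℤ)) =
        ((m * n - (m - t + 1) * (n - t + 1) : ℕ) : WithBot ℕ∞) := by
  set I := detIdeal (R := MvPolynomial (Fin m × Fin n) F)
    (Matrix.of fun i j => MvPolynomial.X (i, j)) (t : ℤ) with hI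
  obtain ⟨r, rfl⟩ : ∃ r, t = r + 1 := ⟨t - 1, by omega⟩
  have hr : r + 1 ≤ m ∧ r + 1 ≤ n := le_min_iff.mp ht2
  have hmr : m - (r + 1) + 1 = m - r := by omega
  have hnr : n - (r + 1) + 1 = n - r := by omega
  rw [hmr, hnr]
  have hheight : ∀ p : PrimeSpectrum (MvPolynomial (Fin m × Fin n) F), I ≤ p.asIdeal →
      (((m - r) * (n - r) : ℕ) : ℕ∞) ≤ Order.height p := by
    intro p hp
    have h := MvPolynomial.le_height_of_minors_mem r p.asIdeal fun f g => ?_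
    · simpa [PrimeSpectrum.height_eq_orderHeight] using h
    by_cases hf : Function.Injective f
    · by_cases hg : Function.Injective g
      · exact hp (Ideal.subset_span ⟨f, g, hf, hg, rfl⟩)
      · simp only [Function.Injective, not_forall] at hg
        obtain ⟨i, j, hij, hne⟩ := hg
        rw [Matrix.det_zero_of_column_eq hne fun k => by simp [hij]]
        exact zero_mem _
    · simp only [Function.Injective, not_forall] at hf
      obtain ⟨i, j, hij, hne⟩ := hf
      rw [Matrix.det_zero_of_row_eq hne (by ext k; simp [hij])]
      exact zero_mem _
  have hdim : ((m * n - (m - r) * (n - r) : ℕ) : WithBot ℕ∞) ≤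
      ringKrullDim (MvPolynomial (Fin m × Fin n) F ⧸ I) := by
    have h := MvPolynomial.le_ringKrullDim_quotient_of_minors (r := r)
      (by simp; omega) (by simp; omega) I (Ideal.span_mono fun d hd => ?_)
    · simpa only [Fintype.card_fin] using h
    · obtain ⟨f, g, -, -, rfl⟩ := hd
      exact ⟨f, g, rfl⟩
  have htotal : ringKrullDim (MvPolynomial (Fin m × Fin n) F) = ((m * n : ℕ) : WithBot ℕ∞) := by
    rw [MvPolynomial.ringKrullDim_of_isNoetherianRing, ringKrullDim_eq_zero_of_field]
    simp
  have hle : (m - r) * (n - r) ≤ m * n := Nat.mul_le_mul (Nat.sub_le _ _) (Nat.sub_le _ _)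
  constructor
  · refine le_antisymm (le_of_not_gt fun hlt => ?_) (le_iInf₂ hheight)
    have h := I.add_le_ringKrullDim (h := (m - r) * (n - r) + 1)
      (fun p hp => by
        push_cast
        exact (Order.add_one_le_of_lt (by exact_mod_cast hlt)).trans (iInf₂_le p hp)) hdim
    rw [htotal] at h
    norm_cast at h
    omega
  · refine le_antisymm (le_of_not_gt fun hlt => ?_) hdim
    have h := I.add_le_ringKrullDim (d := m * n - (m - r) * (n - r) + 1) hheight
      (by
        push_cast
        exact ENat.WithBot.add_one_le_iff.mpr (by exact_mod_cast hlt))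
    rw [htotal] at h
    norm_cast at h
    omega
end
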